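/- Assume G ≅ C_{n1} ⊕ … ⊕ C_{nr} with 1 < n1 | … | nr and D(G) ≥ 4, and suppose r = nr − 1 ≥ 3. If n1 = nr = p^k for some prime p and k ∈ ℕ, then K(G, r−1) < ρ*(G, r−1) = 1 + (r+1)(r−1)/(r+2) < r. Otherwise, K(G, r−1) = ρ*(G, r−1). -/

import Mathlib

/- Common definitions: zero-sum sequences over a finite abelian group,
   sets of lengths, the system of sets of lengths, the Davenport constant,
   sets of distances, elasticities, AAPs, Δ₁(G), ρ(G,d,k), ρ(G,d), ρ*(G,d),
   cross numbers, K(G₀), K(G,d), LCN-sets, Δ*(G). -/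

open scoped Classical

section Defs

variable {G : Type*} [AddCommGroup G]

/-- The support of a sequence (multiset) over `G`. -/
def suppSet (A : Multiset G) : Set G := {g | g ∈ A}

/-- `A` is a minimal zero-sum sequence (an atom of `𝓑(G₀)`) over `G₀ ⊆ G`:
a nontrivial zero-sum sequence with terms in `G₀` such that every proper
nontrivial subsequence has nonzero sum. -/
def IsMinZeroSum (G0 : Set G) (A : Multiset G) : Prop :=
  A ≠ 0 ∧ (∀ g ∈ A, g ∈ G0) ∧ A.sum = 0 ∧
    ∀ T : Multiset G, T ≤ A → T.sum = 0 → T = 0 ∨ T = A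

/-- `B` is a zero-sum sequence over `G₀ ⊆ G` (an element of `𝓑(G₀)`). -/
def IsZeroSumSeq (G0 : Set G) (B : Multiset G) : Prop :=
  (∀ g ∈ B, g ∈ G0) ∧ B.sum = 0

/-- The set of lengths `L(B)` of a zero-sum sequence `B` over `G₀`:
all `k` such that `B` is a product of `k` atoms of `𝓑(G₀)`.
(For the trivial sequence this is `{0}`.) -/
def lengthSet (G0 : Set G) (B : Multiset G) : Set ℕ :=
  {k | ∃ U : Fin k → Multiset G, (∀ i, IsMinZeroSum G0 (U i)) ∧ B = ∑ i, U i}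

/-- The system of sets of lengths `𝓛(G₀)`. -/
def systemL (G0 : Set G) : Set (Set ℕ) :=
  {L | ∃ B : Multiset G, IsZeroSumSeq G0 B ∧ L = lengthSet G0 B}

/-- The Davenport constant `D(G)`: the maximal length of a minimal zero-sum
sequence over `G`. -/
noncomputable def davenport (G : Type*) [AddCommGroup G] : ℕ :=
  sSup {m | ∃ A : Multiset G, IsMinZeroSum (Set.univ : Set G) A ∧ Multiset.card A = m}

/-- The set of successive distances `Δ(L)` of a set `L ⊆ ℕ`. -/
def deltaOf (L : Set ℕ) : Set ℕ :=
  {d | 0 < d ∧ ∃ a, a ∈ L ∧ a + d ∈ L ∧ ∀ c ∈ L, ¬(a < c ∧ c < a + d)}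

/-- `Δ(G₀) = ⋃_{L ∈ 𝓛(G₀)} Δ(L)`. -/
def deltaG0 (G0 : Set G) : Set ℕ := ⋃ L ∈ systemL G0, deltaOf L

/-- `Δ*(G) = {min Δ(G₀) : G₀ ⊆ G with Δ(G₀) ≠ ∅}`. -/
def deltaStar (G : Type*) [AddCommGroup G] : Set ℕ :=
  {d | ∃ G0 : Set G, deltaG0 G0 ≠ ∅ ∧ d = sInf (deltaG0 G0)}

/-- The elasticity `ρ(L) = max L / min L` of a (finite) set `L ⊆ ℕ`,
with the convention `ρ({0}) = 1`. -/
noncomputable def rhoL (L : Set ℕ) : ℝ :=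
  if sInf L = 0 then 1 else ((sSup L : ℕ) : ℝ) / ((sInf L : ℕ) : ℝ)

/-- The elasticity `ρ(G₀) = sup {ρ(L) : L ∈ 𝓛(G₀)}`. -/
noncomputable def rhoG0 (G0 : Set G) : ℝ := sSup (rhoL '' systemL G0)

/-- `L` (a set of naturals) is an almost arithmetical progression (AAP)
with difference `d`, length `ℓ` and bound `M`:
`L = y + (L' ∪ {0, d, …, ℓd} ∪ L'') ⊆ y + dℤ` with `L' ⊆ [−M, −1]` and
`L'' ⊆ ℓd + [1, M]`. -/
def IsAAP (L : Set ℕ) (d ℓ M : ℕ) : Prop :=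
  ∃ (y : ℤ) (L1 L2 : Set ℤ),
    L1 ⊆ Set.Icc (-(M : ℤ)) (-1) ∧
    L2 ⊆ Set.Icc ((ℓ : ℤ) * d + 1) ((ℓ : ℤ) * d + M) ∧
    ((fun x : ℕ => (x : ℤ)) '' L) =
      (fun x => y + x) '' (L1 ∪ (fun i : ℤ => (d : ℤ) * i) '' Set.Icc (0 : ℤ) (ℓ : ℤ) ∪ L2) ∧
    (∀ x ∈ L, (d : ℤ) ∣ ((x : ℤ) - y))

/-- `Δ₁(G)`: the set of `d ∈ ℕ` such that for every `k` there is some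
`L ∈ 𝓛(G)` which is an AAP with difference `d` and length at least `k`. -/
def delta1 (G : Type*) [AddCommGroup G] : Set ℕ :=
  {d | 0 < d ∧ ∀ k : ℕ, ∃ L ∈ systemL (Set.univ : Set G), ∃ ℓ ≥ k, ∃ M : ℕ, IsAAP L d ℓ M}

/-- `ρ(G, d, k)`: the supremum of elasticities of sets of lengths of `G` which
are AAPs with difference `d` and length at least `k`. -/
noncomputable def rhoGdk (G : Type*) [AddCommGroup G] (d k : ℕ) : ℝ :=
  sSup (rhoL '' {L | L ∈ systemL (Set.univ : Set G) ∧ ∃ ℓ ≥ k, ∃ M : ℕ, IsAAP L d ℓ M})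

/-- `ρ(G, d)`: the limit of the decreasing sequence `(ρ(G, d, k))_k`,
i.e. its infimum. -/
noncomputable def rhoGd (G : Type*) [AddCommGroup G] (d : ℕ) : ℝ :=
  ⨅ k : ℕ, rhoGdk G d k

/-- `ρ*(G, d) = max {ρ(G₀) : G₀ ⊆ G non-half-factorial with d ∣ min Δ(G₀)}`. -/
noncomputable def rhoStar (G : Type*) [AddCommGroup G] (d : ℕ) : ℝ :=
  sSup {x | ∃ G0 : Set G, deltaG0 G0 ≠ ∅ ∧ d ∣ sInf (deltaG0 G0) ∧ x = rhoG0 G0}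

/-- The cross number `k(S) = Σ_{g ∈ S} 1/ord(g)` of a sequence `S`. -/
noncomputable def crossNum (S : Multiset G) : ℝ :=
  (S.map (fun g => (1 : ℝ) / (addOrderOf g))).sum

/-- `K(G₀) = max {k(A) : A ∈ 𝓐(G₀)}`, the cross number of `G₀`. -/
noncomputable def KG0 (G0 : Set G) : ℝ :=
  sSup {x | ∃ A : Multiset G, IsMinZeroSum G0 A ∧ x = crossNum A}

/-- `K(G, d) = max {K(G₀) : G₀ ⊆ G non-half-factorial with d ∣ min Δ(G₀)}`. -/
noncomputable def KGd (G : Type*) [AddCommGroup G] (d : ℕ) : ℝ :=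
  sSup {x | ∃ G0 : Set G, deltaG0 G0 ≠ ∅ ∧ d ∣ sInf (deltaG0 G0) ∧ x = KG0 G0}

/-- `G₀` is an LCN-set: `k(A) ≥ 1` for every atom `A` of `𝓑(G₀)`. -/
def IsLCN (G0 : Set G) : Prop :=
  ∀ A : Multiset G, IsMinZeroSum G0 A → 1 ≤ crossNum A

end Defs

section Part1

set_option linter.unusedSectionVars false

section Basics
variable {G : Type*} [AddCommGroup G]

/-- A factorization into atoms, as a multiset of atoms. -/
def IsFac (G0 : Set G) (F : Multiset (Multiset G)) : Prop := ∀ U ∈ F, IsMinZeroSum G0 U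

lemma mem_lengthSet_iff {G0 : Set G} {B : Multiset G} {k : ℕ} :
    k ∈ lengthSet G0 B ↔ ∃ F, IsFac G0 F ∧ F.sum = B ∧ Multiset.card F = k := by
  constructor
  · rintro ⟨U, hU, hB⟩
    refine ⟨Finset.univ.val.map U, ?_, ?_, ?_⟩
    · intro V hV
      rw [Multiset.mem_map] at hV
      obtain ⟨i, -, rfl⟩ := hV
      exact hU i
    · rw [hB]; rfl
    · simp
  · rintro ⟨F, hF, hB, hk⟩
    induction F using Quot.inductionOn with
    | h l =>
      have hk' : l.length = k := by simpa using hk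
      subst hk'
      refine ⟨fun i => l.get i, ?_, ?_⟩
      · intro i
        exact hF _ (by simp)
      · rw [← hB, ← List.sum_ofFn, List.ofFn_get]
        simp

lemma IsMinZeroSum.mono {G0 G1 : Set G} {A : Multiset G} (h : IsMinZeroSum G0 A)
    (h1 : ∀ g ∈ A, g ∈ G1) : IsMinZeroSum G1 A := ⟨h.1, h1, h.2.2.1, h.2.2.2⟩

lemma IsMinZeroSum.eq_of_le {G0 : Set G} {A T : Multiset G} (h : IsMinZeroSum G0 A)
    (hT : T ≤ A) (h0 : T.sum = 0) (hne : T ≠ 0) : T = A :=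
  (h.2.2.2 T hT h0).resolve_left hne

lemma IsMinZeroSum.zs {G0 : Set G} {A : Multiset G} (h : IsMinZeroSum G0 A) :
    IsZeroSumSeq G0 A := ⟨h.2.1, h.2.2.1⟩

lemma IsZeroSumSeq.add {G0 : Set G} {A B : Multiset G} (h : IsZeroSumSeq G0 A)
    (h' : IsZeroSumSeq G0 B) : IsZeroSumSeq G0 (A + B) := by
  refine ⟨fun g hg => ?_, ?_⟩
  · rcases Multiset.mem_add.1 hg with hg | hg
    · exact h.1 g hg
    · exact h'.1 g hg
  · rw [Multiset.sum_add, h.2, h'.2, add_zero]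

lemma IsZeroSumSeq.nsmul {G0 : Set G} {A : Multiset G} (h : IsZeroSumSeq G0 A) (k : ℕ) :
    IsZeroSumSeq G0 (k • A) := by
  refine ⟨fun g hg => h.1 g (Multiset.mem_of_mem_nsmul hg), ?_⟩
  rw [Multiset.sum_nsmul, h.2, smul_zero]

lemma IsFac.zs {G0 : Set G} {F : Multiset (Multiset G)} (h : IsFac G0 F) :
    IsZeroSumSeq G0 F.sum := by
  induction F using Multiset.induction_on with
  | empty => exact ⟨by simp, by simp⟩
  | cons a s ih =>
    rw [Multiset.sum_cons]
    exact (h a (by simp)).zs.add (ih fun U hU => h U (by simp [hU]))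

lemma IsFac.add {G0 : Set G} {F F' : Multiset (Multiset G)} (h : IsFac G0 F) (h' : IsFac G0 F') :
    IsFac G0 (F + F') := by
  intro U hU
  rcases Multiset.mem_add.1 hU with hg | hg
  · exact h U hg
  · exact h' U hg

lemma IsFac.nsmul {G0 : Set G} {F : Multiset (Multiset G)} (h : IsFac G0 F) (k : ℕ) :
    IsFac G0 (k • F) := fun U hU => h U (Multiset.mem_of_mem_nsmul hU)

lemma isFac_singleton {G0 : Set G} {U : Multiset G} (h : IsMinZeroSum G0 U) :
    IsFac G0 {U} := by
  intro V hV
  rw [Multiset.mem_singleton] at hV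
  rw [hV]; exact h

lemma isFac_zero {G0 : Set G} : IsFac G0 0 := by
  intro V hV
  simp at hV

lemma isFac_sum {G0 : Set G} {ι : Type*} (s : Finset ι) (F : ι → Multiset (Multiset G))
    (h : ∀ i ∈ s, IsFac G0 (F i)) : IsFac G0 (∑ i ∈ s, F i) := by
  intro U hU
  rw [Multiset.mem_sum] at hU
  obtain ⟨i, hi, hU⟩ := hU
  exact h i hi U hU

lemma exists_fac {G0 : Set G} : ∀ (k : ℕ) (B : Multiset G), Multiset.card B ≤ k →
    IsZeroSumSeq G0 B → ∃ F, IsFac G0 F ∧ F.sum = B := by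
  intro k
  induction k with
  | zero =>
    intro B hB _
    have : B = 0 := by rw [← Multiset.card_eq_zero]; omega
    exact ⟨0, isFac_zero, by simp [this]⟩
  | succ k ih =>
    intro B hB hz
    by_cases h0 : B = 0
    · exact ⟨0, isFac_zero, by simp [h0]⟩
    by_cases hA : IsMinZeroSum G0 B
    · exact ⟨{B}, isFac_singleton hA, by simp⟩
    have : ∃ T ≤ B, T.sum = 0 ∧ T ≠ 0 ∧ T ≠ B := by
      by_contra hcon
      push Not at hcon
      refine hA ⟨h0, hz.1, hz.2, fun T hT hs => ?_⟩
      by_cases hT0 : T = 0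
      · exact Or.inl hT0
      · exact Or.inr (hcon T hT hs hT0)
    obtain ⟨T, hT, hs, hT0, hTB⟩ := this
    have hsum : T + (B - T) = B := add_tsub_cancel_of_le hT
    have hc : Multiset.card T + Multiset.card (B - T) = Multiset.card B := by
      rw [← Multiset.card_add, hsum]
    have hc1 : 0 < Multiset.card T := Multiset.card_pos.2 hT0
    have hc2 : 0 < Multiset.card (B - T) := by
      rw [Multiset.card_pos]
      intro h
      rw [h, add_zero] at hsum
      exact hTB hsum
    have hs2 : (B - T).sum = 0 := by
      have := congrArg Multiset.sum hsum
      rw [Multiset.sum_add, hs, zero_add, hz.2] at this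
      exact this
    obtain ⟨F1, hF1, h1⟩ := ih T (by omega) ⟨fun g hg => hz.1 g (Multiset.mem_of_le hT hg), hs⟩
    obtain ⟨F2, hF2, h2⟩ := ih (B - T) (by omega)
      ⟨fun g hg => hz.1 g (Multiset.mem_of_le (Multiset.sub_le_self B T) hg), hs2⟩
    exact ⟨F1 + F2, hF1.add hF2, by rw [Multiset.sum_add, h1, h2, hsum]⟩

lemma IsZeroSumSeq.exists_fac {G0 : Set G} {B : Multiset G} (h : IsZeroSumSeq G0 B) :
    ∃ F, IsFac G0 F ∧ F.sum = B := _root_.exists_fac _ B le_rfl h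

/-- Additive weights. -/
noncomputable def wt {M : Type*} [AddCommMonoid M] (w : G → M) (B : Multiset G) : M := (B.map w).sum

lemma wt_add {M : Type*} [AddCommMonoid M] (w : G → M) (A B : Multiset G) :
    wt w (A + B) = wt w A + wt w B := by simp [wt]

lemma wt_zero {M : Type*} [AddCommMonoid M] (w : G → M) : wt w (0 : Multiset G) = 0 := by simp [wt]

lemma wt_singleton {M : Type*} [AddCommMonoid M] (w : G → M) (g : G) :
    wt w ({g} : Multiset G) = w g := by simp [wt]

lemma wt_nsmul {M : Type*} [AddCommMonoid M] (w : G → M) (k : ℕ) (B : Multiset G) :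
    wt w (k • B) = k • wt w B := by
  simp [wt, Multiset.map_nsmul, Multiset.sum_nsmul]

lemma crossNum_eq (A : Multiset G) : crossNum A = wt (fun g => (1 : ℝ) / (addOrderOf g)) A := rfl

lemma fac_wt_ge {G0 : Set G} (w : G → ℝ) (F : Multiset (Multiset G)) (hF : IsFac G0 F)
    (c : ℝ) (hw : ∀ U, IsMinZeroSum G0 U → c ≤ wt w U) :
    c * Multiset.card F ≤ wt w F.sum := by
  induction F using Multiset.induction_on with
  | empty => simp [wt]
  | cons a s ih =>
    rw [Multiset.sum_cons, wt_add, Multiset.card_cons]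
    have h1 := hw a (hF a (by simp))
    have h2 := ih fun U hU => hF U (by simp [hU])
    push_cast
    linarith

lemma fac_wt_le {G0 : Set G} (w : G → ℝ) (F : Multiset (Multiset G)) (hF : IsFac G0 F)
    (c : ℝ) (hw : ∀ U, IsMinZeroSum G0 U → wt w U ≤ c) :
    wt w F.sum ≤ c * Multiset.card F := by
  induction F using Multiset.induction_on with
  | empty => simp [wt]
  | cons a s ih =>
    rw [Multiset.sum_cons, wt_add, Multiset.card_cons]
    have h1 := hw a (hF a (by simp))
    have h2 := ih fun U hU => hF U (by simp [hU])
    push_cast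
    linarith

lemma lengthSet_bdd (G0 : Set G) (B : Multiset G) : BddAbove (lengthSet G0 B) := by
  refine ⟨Multiset.card B, fun k hk => ?_⟩
  obtain ⟨F, hF, hB, rfl⟩ := mem_lengthSet_iff.1 hk
  have := fac_wt_ge (fun _ => (1:ℝ)) F hF 1 (fun U hU => by
    have := Multiset.card_pos.2 hU.1
    simp [wt]
    exact_mod_cast this)
  rw [hB] at this
  simp [wt] at this
  exact this

lemma lengthSet_nonempty {G0 : Set G} {B : Multiset G} (h : IsZeroSumSeq G0 B) :
    (lengthSet G0 B).Nonempty := by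
  obtain ⟨F, hF, hB⟩ := h.exists_fac
  exact ⟨_, mem_lengthSet_iff.2 ⟨F, hF, hB, rfl⟩⟩

lemma zs_zero (G0 : Set G) : IsZeroSumSeq G0 (0 : Multiset G) := ⟨by simp, by simp⟩

lemma rhoL_le {G0 : Set G} (w : G → ℝ) (c : ℝ) (hc : 1 ≤ c)
    (hw : ∀ U, IsMinZeroSum G0 U → 1 ≤ wt w U ∧ wt w U ≤ c) :
    ∀ x ∈ rhoL '' systemL G0, x ≤ c := by
  rintro x ⟨L, ⟨B, hB, rfl⟩, rfl⟩
  unfold rhoL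
  split_ifs with h0
  · exact hc
  have hmin := Nat.sInf_mem (lengthSet_nonempty hB)
  have hmax := Nat.sSup_mem (lengthSet_nonempty hB) (lengthSet_bdd G0 B)
  rw [div_le_iff₀ (by exact_mod_cast Nat.pos_of_ne_zero h0)]
  obtain ⟨F, hF, hFB, hFk⟩ := mem_lengthSet_iff.1 hmax
  obtain ⟨F', hF', hFB', hFk'⟩ := mem_lengthSet_iff.1 hmin
  have h1 := fac_wt_ge w F hF 1 fun U hU => (hw U hU).1
  have h2 := fac_wt_le w F' hF' c fun U hU => (hw U hU).2
  rw [hFB, hFk] at h1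
  rw [hFB', hFk'] at h2
  linarith

lemma rhoG0_le {G0 : Set G} (w : G → ℝ) (c : ℝ) (hc : 1 ≤ c)
    (hw : ∀ U, IsMinZeroSum G0 U → 1 ≤ wt w U ∧ wt w U ≤ c) : rhoG0 G0 ≤ c := by
  refine csSup_le ?_ (rhoL_le w c hc hw)
  exact ⟨_, _, ⟨0, zs_zero G0, rfl⟩, rfl⟩

variable [Fintype G]

lemma atom_count_le {G0 : Set G} {A : Multiset G} (h : IsMinZeroSum G0 A) (g : G) :
    A.count g ≤ addOrderOf g := by
  by_contra hcon
  push Not at hcon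
  have hle : Multiset.replicate (addOrderOf g) g ≤ A := Multiset.le_count_iff_replicate_le.1 hcon.le
  have hpos : 0 < addOrderOf g := addOrderOf_pos g
  have := h.eq_of_le hle (by simp [addOrderOf_nsmul_eq_zero]) (by
    intro h0
    have := congrArg Multiset.card h0
    simp only [Multiset.card_replicate, Multiset.card_zero] at this
    omega)
  rw [← this] at hcon
  simp at hcon

lemma wt_eq_sum {M : Type*} [AddCommMonoid M] (w : G → M) (A : Multiset G) :
    wt w A = ∑ g : G, A.count g • w g := by
  unfold wt
  rw [Finset.sum_multiset_map_count]
  refine Finset.sum_subset (Finset.subset_univ _) fun x _ hx => ?_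
  rw [Multiset.mem_toFinset] at hx
  rw [Multiset.count_eq_zero_of_notMem hx, zero_smul]

lemma atom_card_le {G0 : Set G} {A : Multiset G} (h : IsMinZeroSum G0 A) :
    wt (fun _ => (1:ℝ)) A ≤ ∑ g : G, (addOrderOf g : ℝ) := by
  rw [wt_eq_sum]
  refine Finset.sum_le_sum fun g _ => ?_
  simp only [nsmul_eq_mul, mul_one]
  exact_mod_cast atom_count_le h g

lemma atom_one_le_card {G0 : Set G} {A : Multiset G} (h : IsMinZeroSum G0 A) :
    1 ≤ wt (fun _ => (1:ℝ)) A := by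
  have := Multiset.card_pos.2 h.1
  simp [wt]
  exact_mod_cast this

lemma rhoL_bdd (G0 : Set G) : BddAbove (rhoL '' systemL G0) := by
  refine ⟨max 1 (∑ g : G, (addOrderOf g : ℝ)), rhoL_le (fun _ => (1:ℝ)) _ (le_max_left _ _) ?_⟩
  intro U hU
  exact ⟨atom_one_le_card hU, (atom_card_le hU).trans (le_max_right _ _)⟩

lemma le_rhoG0 {G0 : Set G} (F F' : Multiset (Multiset G)) (hF : IsFac G0 F) (hF' : IsFac G0 F')
    (h : F.sum = F'.sum) (hne : F' ≠ 0) :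
    (Multiset.card F : ℝ) / Multiset.card F' ≤ rhoG0 G0 := by
  have hmem : rhoL (lengthSet G0 F.sum) ∈ rhoL '' systemL G0 := ⟨_, ⟨_, hF.zs, rfl⟩, rfl⟩
  refine le_trans ?_ (le_csSup (rhoL_bdd G0) hmem)
  have hk : Multiset.card F ∈ lengthSet G0 F.sum := mem_lengthSet_iff.2 ⟨F, hF, rfl, rfl⟩
  have hk' : Multiset.card F' ∈ lengthSet G0 F.sum := mem_lengthSet_iff.2 ⟨F', hF', h.symm, rfl⟩
  have h0 : sInf (lengthSet G0 F.sum) ≠ 0 := by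
    intro h0
    have hmin := Nat.sInf_mem ⟨_, hk⟩
    rw [h0] at hmin
    obtain ⟨F0, hF0, hs, hc⟩ := mem_lengthSet_iff.1 hmin
    rw [Multiset.card_eq_zero] at hc
    subst hc
    rw [Multiset.sum_zero, h] at hs
    obtain ⟨U, hU⟩ := Multiset.exists_mem_of_ne_zero hne
    have hle : U ≤ F'.sum := Multiset.le_sum_of_mem hU
    rw [← hs] at hle
    exact (hF' U hU).1 (Multiset.le_zero.1 hle)
  unfold rhoL
  rw [if_neg h0]
  have h1 : Multiset.card F ≤ sSup (lengthSet G0 F.sum) := le_csSup (lengthSet_bdd _ _) hk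
  have h2 : sInf (lengthSet G0 F.sum) ≤ Multiset.card F' := Nat.sInf_le hk'
  have h3 : 0 < sInf (lengthSet G0 F.sum) := Nat.pos_of_ne_zero h0
  gcongr

lemma crossNum_bdd (G0 : Set G) : BddAbove {x | ∃ A : Multiset G, IsMinZeroSum G0 A ∧ x = crossNum A} := by
  refine ⟨Fintype.card G, ?_⟩
  rintro x ⟨A, hA, rfl⟩
  rw [crossNum_eq, wt_eq_sum]
  calc _ ≤ ∑ g : G, (1:ℝ) := by
        refine Finset.sum_le_sum fun g _ => ?_
        have hpos : (0:ℝ) < addOrderOf g := by exact_mod_cast addOrderOf_pos g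
        rw [nsmul_eq_mul, mul_one_div, div_le_one hpos]
        exact_mod_cast atom_count_le hA g
    _ = _ := by simp

lemma le_KG0 {G0 : Set G} {A : Multiset G} (h : IsMinZeroSum G0 A) : crossNum A ≤ KG0 G0 :=
  le_csSup (crossNum_bdd G0) ⟨A, h, rfl⟩

/-- `addOrderOf g` copies of `g` form an atom. -/
lemma atom_ord {G0 : Set G} {g : G} (hg : g ∈ G0) : IsMinZeroSum G0 (addOrderOf g • ({g} : Multiset G)) := by
  have hpos : 0 < addOrderOf g := addOrderOf_pos g
  rw [Multiset.nsmul_singleton]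
  refine ⟨?_, ?_, ?_, ?_⟩
  · intro h0
    have := congrArg Multiset.card h0
    simp only [Multiset.card_replicate, Multiset.card_zero] at this
    omega
  · intro x hx
    rw [Multiset.eq_of_mem_replicate hx]; exact hg
  · simp [addOrderOf_nsmul_eq_zero]
  · intro T hT hs
    obtain ⟨k, hk, rfl⟩ := Multiset.le_replicate_iff.1 hT
    rw [Multiset.sum_replicate] at hs
    have := addOrderOf_dvd_of_nsmul_eq_zero hs
    rcases Nat.eq_zero_or_pos k with h0 | h0
    · left; simp [h0]
    · right
      rw [le_antisymm hk (Nat.le_of_dvd h0 this)]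

/-- `h + (-h)` is an atom. -/
lemma atom_pair {G0 : Set G} {h : G} (h1 : h ∈ G0) (h2 : -h ∈ G0) (h0 : h ≠ 0) :
    IsMinZeroSum G0 ({h} + {-h} : Multiset G) := by
  refine ⟨?_, ?_, by simp, ?_⟩
  · intro h
    have := congrArg Multiset.card h
    simp at this
  · intro x hx
    simp at hx
    rcases hx with rfl | rfl <;> assumption
  · intro T hT hs
    have hc := Multiset.card_le_card hT
    simp at hc
    by_cases hT0 : T = 0
    · exact Or.inl hT0
    right
    refine Multiset.eq_of_le_of_card_le hT ?_
    by_contra hcon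
    have hpos := Multiset.card_pos.2 hT0
    simp at hcon
    obtain ⟨a, rfl⟩ := Multiset.card_eq_one.1 (show Multiset.card T = 1 by omega)
    have ha : a ∈ ({h} + {-h} : Multiset G) := Multiset.mem_of_le hT (by simp)
    simp at hs ha
    subst hs
    rcases ha with ha | ha
    · exact h0 ha.symm
    · exact h0 (by simpa using ha.symm)

end Basics


end Part1

section Part2

set_option linter.unusedSectionVars false

section Delta
variable {G : Type*} [AddCommGroup G]

lemma delta_exists {G0 : Set G} {F F' : Multiset (Multiset G)} (hF : IsFac G0 F)
    (hF' : IsFac G0 F') (h : F.sum = F'.sum) (hlt : Multiset.card F < Multiset.card F') :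
    ∃ e ∈ deltaG0 G0, e ≤ Multiset.card F' - Multiset.card F := by
  have hk : Multiset.card F ∈ lengthSet G0 F.sum := mem_lengthSet_iff.2 ⟨F, hF, rfl, rfl⟩
  have hk' : Multiset.card F' ∈ lengthSet G0 F.sum := mem_lengthSet_iff.2 ⟨F', hF', h.symm, rfl⟩
  have hex : ∃ c, c ∈ lengthSet G0 F.sum ∧ Multiset.card F < c := ⟨_, hk', hlt⟩
  have hs := Nat.find_spec hex
  have hmin : ∀ c, c ∈ lengthSet G0 F.sum ∧ Multiset.card F < c → Nat.find hex ≤ c :=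
    fun c hc => Nat.find_min' hex hc
  set m := Nat.find hex with hm
  refine ⟨m - Multiset.card F, ?_, ?_⟩
  · unfold deltaG0
    simp only [Set.mem_iUnion]
    refine ⟨lengthSet G0 F.sum, ⟨_, hF.zs, rfl⟩, ?_, Multiset.card F, hk, ?_, ?_⟩
    · omega
    · rw [Nat.add_sub_cancel' hs.2.le]; exact hs.1
    · rintro c hc ⟨h1, h2⟩
      have := hmin c ⟨hc, h1⟩
      omega
  · have := hmin _ ⟨hk', hlt⟩
    omega

lemma delta_ne {G0 : Set G} {F F' : Multiset (Multiset G)} (hF : IsFac G0 F)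
    (hF' : IsFac G0 F') (h : F.sum = F'.sum) (hne : Multiset.card F ≠ Multiset.card F') :
    deltaG0 G0 ≠ ∅ := by
  rcases lt_or_gt_of_ne hne with hlt | hlt
  · obtain ⟨e, he, -⟩ := delta_exists hF hF' h hlt
    exact (Set.nonempty_of_mem he).ne_empty
  · obtain ⟨e, he, -⟩ := delta_exists hF' hF h.symm hlt
    exact (Set.nonempty_of_mem he).ne_empty

lemma mem_delta {G0 : Set G} {e : ℕ} (he : e ∈ deltaG0 G0) : 0 < e ∧ ∃ F F', IsFac G0 F ∧
    IsFac G0 F' ∧ F.sum = F'.sum ∧ Multiset.card F' = Multiset.card F + e := by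
  unfold deltaG0 at he
  simp only [Set.mem_iUnion] at he
  obtain ⟨L, ⟨B, hB, rfl⟩, hpos, a, ha, hb, -⟩ := he
  obtain ⟨F, hF, h1, h2⟩ := mem_lengthSet_iff.1 ha
  obtain ⟨F', hF', h1', h2'⟩ := mem_lengthSet_iff.1 hb
  exact ⟨hpos, F, F', hF, hF', by rw [h1, h1'], by omega⟩

/-- Any two factorization lengths agree modulo `d`. -/
def Cong (G0 : Set G) (d : ℕ) : Prop := ∀ F F', IsFac G0 F → IsFac G0 F' → F.sum = F'.sum →
  (d : ℤ) ∣ (Multiset.card F : ℤ) - Multiset.card F'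

lemma dvd_of_cong {G0 : Set G} {d : ℕ} (h : Cong G0 d) : d ∣ sInf (deltaG0 G0) := by
  rcases Set.eq_empty_or_nonempty (deltaG0 G0) with h0 | h0
  · simp [h0]
  · obtain ⟨-, F, F', hF, hF', hs, hc⟩ := mem_delta (Nat.sInf_mem h0)
    have := h F' F hF' hF hs.symm
    rw [hc] at this
    push_cast at this
    rw [add_sub_cancel_left] at this
    exact_mod_cast this

lemma cong_aux {G0 : Set G} (F F' : Multiset (Multiset G)) (hF : IsFac G0 F) (hF' : IsFac G0 F')
    (hs : F.sum = F'.sum) (hlt : Multiset.card F ≤ Multiset.card F') :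
    sInf (deltaG0 G0) ∣ Multiset.card F' - Multiset.card F := by
  by_cases hd : deltaG0 G0 = ∅
  · have : Multiset.card F = Multiset.card F' := by
      by_contra hne
      exact delta_ne hF hF' hs hne hd
    simp [this]
  have hmem := Nat.sInf_mem (Set.nonempty_iff_ne_empty.2 hd)
  have hmin : ∀ e ∈ deltaG0 G0, sInf (deltaG0 G0) ≤ e := fun e he => Nat.sInf_le he
  set e := sInf (deltaG0 G0) with he
  obtain ⟨hpos, E, E', hE, hE', hEs, hEc⟩ := mem_delta hmem
  by_contra hnd
  set m := Multiset.card F' - Multiset.card F with hm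
  have hq : m % e + e * (m / e) = m := Nat.mod_add_div m e
  have hr : 0 < m % e := Nat.pos_of_ne_zero fun h => hnd (Nat.dvd_of_mod_eq_zero h)
  have hr2 : m % e < e := Nat.mod_lt _ hpos
  obtain ⟨x, hx, hx2⟩ := delta_exists (hF.add (hE'.nsmul (m / e))) (hF'.add (hE.nsmul (m / e)))
    (by simp only [Multiset.sum_add, Multiset.sum_nsmul, hs, hEs]) (by
      simp only [Multiset.card_add, Multiset.card_nsmul, hEc]
      rw [Nat.mul_add, mul_comm (m / e) e]
      omega)
  have := hmin x hx
  simp only [Multiset.card_add, Multiset.card_nsmul, hEc] at hx2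
  rw [Nat.mul_add, mul_comm (m / e) e] at hx2
  omega

lemma cong_of_dvd {G0 : Set G} {d : ℕ} (h : d ∣ sInf (deltaG0 G0)) : Cong G0 d := by
  intro F F' hF hF' hs
  rcases le_total (Multiset.card F) (Multiset.card F') with hle | hle
  · have := h.trans (cong_aux F F' hF hF' hs hle)
    rw [← dvd_neg, neg_sub]
    have h2 : ((d : ℕ) : ℤ) ∣ ((Multiset.card F' - Multiset.card F : ℕ) : ℤ) := by exact_mod_cast this
    rwa [Nat.cast_sub hle] at h2
  · have := h.trans (cong_aux F' F hF' hF hs.symm hle)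
    have h2 : ((d : ℕ) : ℤ) ∣ ((Multiset.card F - Multiset.card F' : ℕ) : ℤ) := by exact_mod_cast this
    rwa [Nat.cast_sub hle] at h2

/-- A weight that is `1` modulo `d` on atoms forces congruence of lengths. -/
lemma cong_of_weight {G0 : Set G} {d : ℕ} (w : G → ℝ)
    (h : ∀ U, IsMinZeroSum G0 U → ∃ m : ℤ, wt w U = 1 + d * m) : Cong G0 d := by
  have key : ∀ F, IsFac G0 F → ∃ m : ℤ, wt w F.sum = Multiset.card F + d * m := by
    intro F
    induction F using Multiset.induction_on with
    | empty => intro _; exact ⟨0, by simp [wt]⟩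
    | cons a s ih =>
      intro hF
      obtain ⟨m, hm⟩ := ih fun U hU => hF U (by simp [hU])
      obtain ⟨m', hm'⟩ := h a (hF a (by simp))
      refine ⟨m + m', ?_⟩
      rw [Multiset.sum_cons, wt_add, hm, hm', Multiset.card_cons]
      push_cast
      ring
  intro F F' hF hF' hs
  obtain ⟨m, hm⟩ := key F hF
  obtain ⟨m', hm'⟩ := key F' hF'
  rw [hs, hm'] at hm
  refine ⟨m' - m, ?_⟩
  have : ((Multiset.card F : ℤ) : ℝ) - ((Multiset.card F' : ℤ) : ℝ) = d * (m' - m) := by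
    push_cast
    linarith
  exact_mod_cast this

variable [Fintype G]

lemma fac_ord {G0 : Set G} {n : ℕ} (hexp : ∀ g : G, n • g = 0) (B : Multiset G)
    (hB : ∀ g ∈ B, g ∈ G0) : ∃ F, IsFac G0 F ∧ F.sum = n • B ∧
      Multiset.card F = wt (fun g => n / addOrderOf g) B := by
  induction B using Multiset.induction_on with
  | empty => exact ⟨0, isFac_zero, by simp, by simp [wt]⟩
  | cons g s ih =>
    obtain ⟨F, hF, h1, h2⟩ := ih fun x hx => hB x (by simp [hx])
    refine ⟨(n / addOrderOf g) • {addOrderOf g • ({g} : Multiset G)} + F,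
      ((isFac_singleton (atom_ord (hB g (by simp)))).nsmul _).add hF, ?_, ?_⟩
    · rw [Multiset.sum_add, Multiset.sum_nsmul, Multiset.sum_singleton, smul_smul,
        Nat.div_mul_cancel (addOrderOf_dvd_of_nsmul_eq_zero (hexp g)), h1,
        ← Multiset.singleton_add g s, smul_add]
    · rw [← Multiset.singleton_add g s, wt_add, wt_singleton, ← h2]
      simp

lemma wt_ord {n : ℕ} (hexp : ∀ g : G, n • g = 0) (B : Multiset G) :
    ((wt (fun g => n / addOrderOf g) B : ℕ) : ℝ) = n * crossNum B := by
  rw [crossNum_eq]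
  induction B using Multiset.induction_on with
  | empty => simp [wt]
  | cons g s ih =>
    rw [← Multiset.singleton_add g s, wt_add, wt_add, wt_singleton, wt_singleton, mul_add, ← ih]
    push_cast
    congr 1
    rw [Nat.cast_div (addOrderOf_dvd_of_nsmul_eq_zero (hexp g))
      (by exact_mod_cast (addOrderOf_pos g).ne')]
    ring

lemma KG0_le_rhoG0 {G0 : Set G} {n : ℕ} (hn : 0 < n) (hexp : ∀ g : G, n • g = 0) :
    KG0 G0 ≤ rhoG0 G0 := by
  have hnR : (0:ℝ) < n := by exact_mod_cast hn
  by_cases hA : ∃ A, IsMinZeroSum G0 A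
  · refine csSup_le ?_ ?_
    · obtain ⟨A, hA⟩ := hA
      exact ⟨_, A, hA, rfl⟩
    · rintro x ⟨A, hA, rfl⟩
      obtain ⟨F, hF, h1, h2⟩ := fac_ord hexp A hA.2.1
      have := le_rhoG0 F (n • {A}) hF ((isFac_singleton hA).nsmul n)
        (by rw [h1, Multiset.sum_nsmul, Multiset.sum_singleton]) (by
          intro h0
          have := congrArg Multiset.card h0
          simp at this
          omega)
      rw [h2, wt_ord hexp] at this
      simp only [Multiset.card_nsmul, Multiset.card_singleton, mul_one] at this
      rwa [mul_div_cancel_left₀ _ hnR.ne'] at this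
  · have h0 : KG0 G0 = 0 := by
      unfold KG0
      convert Real.sSup_empty
      ext x
      simp only [Set.mem_setOf_eq, Set.mem_empty_iff_false, iff_false]
      rintro ⟨A, hA', -⟩
      exact hA ⟨A, hA'⟩
    rw [h0]
    refine le_trans ?_ (le_csSup (rhoL_bdd G0) ⟨lengthSet G0 0, ⟨0, zs_zero G0, rfl⟩, rfl⟩)
    unfold rhoL
    split_ifs
    · norm_num
    · positivity

/-- An atom of cross number different from one shows that `G0` is not half-factorial. -/
lemma delta_ne_of_crossNum {G0 : Set G} {n : ℕ} (hn : 0 < n) (hexp : ∀ g : G, n • g = 0)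
    {A : Multiset G} (hA : IsMinZeroSum G0 A) (h : crossNum A ≠ 1) : deltaG0 G0 ≠ ∅ := by
  have hnR : (0:ℝ) < n := by exact_mod_cast hn
  obtain ⟨F, hF, h1, h2⟩ := fac_ord hexp A hA.2.1
  refine delta_ne hF ((isFac_singleton hA).nsmul n)
    (by rw [h1, Multiset.sum_nsmul, Multiset.sum_singleton]) ?_
  intro hc
  rw [h2] at hc
  have : ((wt (fun g => n / addOrderOf g) A : ℕ) : ℝ) = n := by
    rw [hc]; simp
  rw [wt_ord hexp] at this
  apply h
  field_simp at this
  exact this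

lemma exists_atom_of_delta {G0 : Set G} (h : deltaG0 G0 ≠ ∅) : ∃ A, IsMinZeroSum G0 A := by
  obtain ⟨e, he⟩ := Set.nonempty_iff_ne_empty.2 h
  obtain ⟨hpos, F, F', hF, hF', -, hc⟩ := mem_delta he
  have : F' ≠ 0 := by
    intro h0
    rw [h0] at hc
    simp at hc
    omega
  obtain ⟨U, hU⟩ := Multiset.exists_mem_of_ne_zero this
  exact ⟨U, hF' U hU⟩

lemma finite_vals (f : Set G → ℝ) (P : Set G → Prop) (Q : Set G → Prop) :
    BddAbove {x | ∃ G0 : Set G, P G0 ∧ Q G0 ∧ x = f G0} := by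
  refine Set.Finite.bddAbove ((Set.finite_range f).subset ?_)
  rintro x ⟨G0, -, -, rfl⟩
  exact ⟨G0, rfl⟩

lemma le_rhoStar {G0 : Set G} {d : ℕ} (h : deltaG0 G0 ≠ ∅) (hd : Cong G0 d) :
    rhoG0 G0 ≤ rhoStar G d :=
  le_csSup (finite_vals _ _ _) ⟨G0, h, dvd_of_cong hd, rfl⟩

lemma le_KGd {G0 : Set G} {d : ℕ} (h : deltaG0 G0 ≠ ∅) (hd : Cong G0 d) :
    KG0 G0 ≤ KGd G d :=
  le_csSup (finite_vals _ _ _) ⟨G0, h, dvd_of_cong hd, rfl⟩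

end Delta

section Lam
variable {G : Type*} [AddCommGroup G]

/-- The length of a zero-sum sequence modulo `d`. -/
noncomputable def lam (G0 : Set G) (d : ℕ) (B : Multiset G) : ZMod d :=
  if h : ∃ F, IsFac G0 F ∧ F.sum = B then (Multiset.card h.choose : ZMod d) else 0

lemma lam_fac {G0 : Set G} {d : ℕ} (hc : Cong G0 d) {F : Multiset (Multiset G)}
    (hF : IsFac G0 F) : lam G0 d F.sum = Multiset.card F := by
  have h : ∃ F', IsFac G0 F' ∧ F'.sum = F.sum := ⟨F, hF, rfl⟩
  unfold lam
  rw [dif_pos h]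
  have := hc _ _ h.choose_spec.1 hF h.choose_spec.2
  have h2 := (ZMod.intCast_zmod_eq_zero_iff_dvd _ d).2 this
  push_cast at h2
  exact sub_eq_zero.1 h2

lemma lam_add {G0 : Set G} {d : ℕ} (hc : Cong G0 d) {A B : Multiset G} (hA : IsZeroSumSeq G0 A)
    (hB : IsZeroSumSeq G0 B) : lam G0 d (A + B) = lam G0 d A + lam G0 d B := by
  obtain ⟨F, hF, rfl⟩ := hA.exists_fac
  obtain ⟨F', hF', rfl⟩ := hB.exists_fac
  rw [← Multiset.sum_add, lam_fac hc (hF.add hF'), lam_fac hc hF, lam_fac hc hF']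
  simp

lemma lam_atom {G0 : Set G} {d : ℕ} (hc : Cong G0 d) {A : Multiset G} (hA : IsMinZeroSum G0 A) :
    lam G0 d A = 1 := by
  have := lam_fac hc (isFac_singleton hA)
  simpa using this

lemma lam_nsmul {G0 : Set G} {d : ℕ} (hc : Cong G0 d) {A : Multiset G} (hA : IsZeroSumSeq G0 A)
    (k : ℕ) : lam G0 d (k • A) = k * lam G0 d A := by
  obtain ⟨F, hF, rfl⟩ := hA.exists_fac
  rw [← Multiset.sum_nsmul, lam_fac hc (hF.nsmul k), lam_fac hc hF]
  simp

lemma lam_sum_atoms {G0 : Set G} {d : ℕ} (hc : Cong G0 d) {ι : Type*} (s : Finset ι)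
    (A : ι → Multiset G) (hA : ∀ i ∈ s, IsMinZeroSum G0 (A i)) :
    IsZeroSumSeq G0 (∑ i ∈ s, A i) ∧ lam G0 d (∑ i ∈ s, A i) = s.card := by
  have h := isFac_sum s (fun i => ({A i} : Multiset (Multiset G)))
    fun i hi => isFac_singleton (hA i hi)
  have h2 : (∑ i ∈ s, ({A i} : Multiset (Multiset G))).sum = ∑ i ∈ s, A i := by
    rw [Multiset.sum_sum]; simp
  have h3 : Multiset.card (∑ i ∈ s, ({A i} : Multiset (Multiset G))) = s.card := by
    simp
  rw [← h2]
  exact ⟨h.zs, by rw [lam_fac hc h, h3]⟩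

end Lam


end Part2

section Part3

set_option linter.unusedSectionVars false

section SeqTools
variable {G : Type*} [AddCommGroup G]

/-- The sequence with multiplicities `y` on the finite set `t`. -/
noncomputable def seqOf (t : Finset G) (y : G → ℕ) : Multiset G := ∑ g ∈ t, y g • ({g} : Multiset G)

lemma count_seqOf (t : Finset G) (y : G → ℕ) (g : G) :
    (seqOf t y).count g = if g ∈ t then y g else 0 := by
  unfold seqOf
  rw [Multiset.count_sum']
  simp [Multiset.count_singleton]

lemma sum_seqOf (t : Finset G) (y : G → ℕ) : (seqOf t y).sum = ∑ g ∈ t, y g • g := by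
  unfold seqOf
  induction t using Finset.induction_on with
  | empty => simp
  | insert a s ha ih => rw [Finset.sum_insert ha, Multiset.sum_add, ih, Finset.sum_insert ha, Multiset.sum_nsmul, Multiset.sum_singleton]

lemma mem_seqOf {t : Finset G} {y : G → ℕ} {g : G} (h : g ∈ seqOf t y) : g ∈ t := by
  by_contra hg
  have := count_seqOf t y g
  rw [if_neg hg] at this
  exact Multiset.count_eq_zero.1 this h

lemma sum_of_supp (A : Multiset G) (t : Finset G) (hA : ∀ g ∈ A, g ∈ t) :
    A.sum = ∑ g ∈ t, A.count g • g :=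
  Finset.sum_multiset_count_of_subset _ _ (fun g hg => hA g (Multiset.mem_toFinset.1 hg))

lemma le_sum_of_mem {F : Multiset (Multiset G)} {V : Multiset G} (h : V ∈ F) : V ≤ F.sum :=
  Multiset.le_sum_of_mem h

lemma fac_count_sum (F : Multiset (Multiset G)) (h : G) :
    F.sum.count h = (F.map (fun V => V.count h)).sum := by
  have := Multiset.count_sum (m := F) (f := id) (a := h)
  simpa using this

lemma fac_count_ge (F : Multiset (Multiset G)) (h : G) (m : ℕ) (hF : ∀ V ∈ F, m ≤ V.count h) :
    m * Multiset.card F ≤ F.sum.count h := by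
  induction F using Multiset.induction_on with
  | empty => simp
  | cons a s ih =>
    have h1 := ih (fun V hV => hF V (Multiset.mem_cons_of_mem hV))
    have h2 := hF a (Multiset.mem_cons_self _ _)
    simp only [Multiset.card_cons, Multiset.sum_cons, Multiset.count_add, mul_add, mul_one]
    omega

lemma fac_count_eq (F : Multiset (Multiset G)) (h : G) (hF : ∀ V ∈ F, 1 ≤ V.count h)
    (hc : F.sum.count h ≤ Multiset.card F) : ∀ V ∈ F, V.count h = 1 := by
  induction F using Multiset.induction_on with
  | empty => simp
  | cons a s ih =>
    have h1 := fac_count_ge s h 1 (fun V hV => hF V (Multiset.mem_cons_of_mem hV))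
    have h2 := hF a (Multiset.mem_cons_self _ _)
    simp only [Multiset.card_cons, Multiset.sum_cons, Multiset.count_add] at hc
    intro V hV
    rcases Multiset.mem_cons.1 hV with rfl | hV
    · omega
    · exact ih (fun V hV => hF V (Multiset.mem_cons_of_mem hV)) (by omega) V hV

lemma eq_zero_of_count {S : Multiset G} (h : ∀ g ∈ S, S.count g = 0) : S = 0 := by
  by_contra h0
  obtain ⟨g, hg⟩ := Multiset.exists_mem_of_ne_zero h0
  exact Multiset.count_ne_zero.2 hg (h g hg)

/-- `t` is independent of exponent exactly `n`. -/
def IndepN (n : ℕ) (t : Finset G) : Prop :=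
  ∀ y : G → ℤ, ∑ g ∈ t, y g • g = 0 → ∀ g ∈ t, (n : ℤ) ∣ y g

lemma zs_dvd {n : ℕ} {t : Finset G} (hi : IndepN n t) {u : G} (hu : u ∉ t) {v : G → ℤ}
    (hv : ∑ g ∈ t, v g • g = -u) {S : Multiset G} (hS : ∀ g ∈ S, g = u ∨ g ∈ t)
    (h0 : S.sum = 0) : ∀ g ∈ t, (n : ℤ) ∣ (S.count g : ℤ) - S.count u * v g := by
  refine hi _ ?_
  have h1 := sum_of_supp S (insert u t) (fun g hg => by simpa using hS g hg)
  rw [h0, Finset.sum_insert hu] at h1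
  simp only [sub_smul, Finset.sum_sub_distrib, mul_smul, ← Finset.smul_sum, hv]
  rw [eq_comm, add_comm] at h1
  simpa using h1

lemma zs_of_dvd {n : ℕ} (hexp : ∀ g : G, n • g = 0) {t : Finset G} {u : G} (hu : u ∉ t)
    {v : G → ℤ}
    (hv : ∑ g ∈ t, v g • g = -u) {S : Multiset G} (hS : ∀ g ∈ S, g = u ∨ g ∈ t)
    (h : ∀ g ∈ t, (n : ℤ) ∣ (S.count g : ℤ) - S.count u * v g) : S.sum = 0 := by
  have h1 := sum_of_supp S (insert u t) (fun g hg => by simpa using hS g hg)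
  rw [Finset.sum_insert hu] at h1
  have h2 : ∑ g ∈ t, ((S.count g : ℤ) - S.count u * v g) • g = 0 := by
    refine Finset.sum_eq_zero fun g hg => ?_
    obtain ⟨m, hm⟩ := h g hg
    rw [hm, mul_comm, mul_smul, natCast_zsmul, hexp, smul_zero]
  simp only [sub_smul, Finset.sum_sub_distrib, mul_smul, ← Finset.smul_sum, hv] at h2
  rw [h1, add_comm]
  simpa using h2

lemma eq_zero_of_no_u {n : ℕ} {t : Finset G} (hi : IndepN n t) {u : G} (hu : u ∉ t) {v : G → ℤ}
    (hv : ∑ g ∈ t, v g • g = -u) {S : Multiset G} (hS : ∀ g ∈ S, g = u ∨ g ∈ t)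
    (h0 : S.sum = 0) (hc : S.count u = 0) (hlt : ∀ g ∈ t, S.count g < n) : S = 0 := by
  refine eq_zero_of_count fun g hg => ?_
  rcases hS g hg with rfl | h
  · exact hc
  · have h1 := zs_dvd hi hu hv hS h0 g h
    rw [hc] at h1
    have h2 : n ∣ S.count g := by simpa [Int.natCast_dvd_natCast] using h1
    exact Nat.eq_zero_of_dvd_of_lt h2 (hlt g h)

lemma sub_zs {S T : Multiset G} (hle : T ≤ S) (h0 : S.sum = 0) (hT : T.sum = 0) :
    (S - T).sum = 0 := by
  have : S.sum = (S - T).sum + T.sum := by rw [← Multiset.sum_add, tsub_add_cancel_of_le hle]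
  rw [h0, hT] at this
  simpa using this.symm

lemma atom_one {n : ℕ} {G0 : Set G} {t : Finset G} (hi : IndepN n t) {u : G}
    (hu : u ∉ t) {v : G → ℤ}
    (hv : ∑ g ∈ t, v g • g = -u) {S : Multiset G} (hS : ∀ g ∈ S, g = u ∨ g ∈ t)
    (hG : ∀ g ∈ S, g ∈ G0)
    (h0 : S.sum = 0) (hc : S.count u = 1) (hlt : ∀ g ∈ t, S.count g < n) : IsMinZeroSum G0 S := by
  refine ⟨fun h => by simp [h] at hc, hG, h0, fun T hT hT0 => ?_⟩
  have hcT := Multiset.count_le_of_le u hT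
  rw [hc] at hcT
  have hlt' : ∀ g ∈ t, T.count g < n := fun g hg => (Multiset.count_le_of_le g hT).trans_lt (hlt g hg)
  interval_cases hh : T.count u
  · exact Or.inl (eq_zero_of_no_u hi hu hv (fun g hg => hS g (Multiset.mem_of_le hT hg)) hT0 hh hlt')
  · right
    have h1 : S - T = 0 := by
      refine eq_zero_of_no_u hi hu hv (fun g hg => hS g (Multiset.mem_of_le (Multiset.sub_le_self _ _) hg))
        (sub_zs hT h0 hT0) (by simp [hc, hh]) (fun g hg => ?_)
      exact (Multiset.count_le_of_le g (Multiset.sub_le_self _ _)).trans_lt (hlt g hg)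
    exact le_antisymm hT (tsub_eq_zero_iff_le.1 h1)

lemma indep_exp_addOrderOf {n : ℕ} (hexp : ∀ g : G, n • g = 0) {t : Finset G} (hi : IndepN n t)
    {g : G} (hg : g ∈ t) : addOrderOf g = n := by
  refine Nat.dvd_antisymm (addOrderOf_dvd_of_nsmul_eq_zero (hexp g)) ?_
  have := hi (fun x => if x = g then (addOrderOf g : ℤ) else 0) ?_ g hg
  · simpa [Int.natCast_dvd_natCast] using this
  · simp [ite_smul, hg]

lemma card_pow_le [Fintype G] {n : ℕ} {t : Finset G} (hi : IndepN n t) :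
    n ^ t.card ≤ Fintype.card G := by
  have hinj : Function.Injective (fun (f : t → Fin n) => ∑ g : t, ((f g : ℕ)) • (g : G)) := by
    intro f f' hff
    have h1 : ∑ g ∈ t, (if hg : g ∈ t then ((f ⟨g, hg⟩ : ℕ) : ℤ) - (f' ⟨g, hg⟩ : ℕ) else 0) • g = 0 := by
      rw [← Finset.sum_coe_sort]
      simp only [Finset.coe_mem, dite_true, Subtype.coe_eta, sub_smul, Finset.sum_sub_distrib,
        natCast_zsmul]
      simpa [sub_eq_zero] using hff
    funext ⟨g, hg⟩
    have h2 := hi _ h1 g hg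
    rw [dif_pos hg] at h2
    have h3 := (f ⟨g, hg⟩).2
    have h4 := (f' ⟨g, hg⟩).2
    have := Int.eq_zero_of_abs_lt_dvd h2 (by rw [abs_lt]; constructor <;> omega)
    apply Fin.ext
    omega
  have := Fintype.card_le_of_injective _ hinj
  simpa using this
end SeqTools


end Part3

section Part4

set_option linter.unusedSectionVars false

section ST
variable {G : Type*} [AddCommGroup G]

/-- Some nonzero multiple of `h` lies in the span of `t`. -/
def PP (h : G) (t : Finset G) : Prop :=
  ∃ (y : G → ℤ) (a : ℤ), a • h ≠ 0 ∧ ∑ g ∈ t, y g • g = a • h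

lemma PP_neg {h : G} {t : Finset G} (H : PP h t) : PP (-h) t := by
  obtain ⟨y, a, ha, hy⟩ := H
  exact ⟨y, -a, by simpa using ha, by simpa using hy⟩

lemma PP_neg_iff {h : G} {t : Finset G} : PP (-h) t ↔ PP h t :=
  ⟨fun H => by simpa using PP_neg H, PP_neg⟩

lemma nat_of_int {n : ℕ} (hn : 0 < n) (hexp : ∀ g : G, n • g = 0) (a : ℤ) (g : G) :
    (a % n).toNat • g = a • g := by
  have h1 : ((a % n).toNat : ℤ) = a % n := Int.toNat_of_nonneg (Int.emod_nonneg _ (by omega))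
  rw [← natCast_zsmul, h1]
  conv_rhs => rw [← Int.emod_add_mul_ediv a n, add_smul, mul_comm, mul_smul, natCast_zsmul, hexp,
    smul_zero, add_zero]

lemma zmod_eq_of_lt {m a b : ℕ} (h : (a : ZMod m) = b) : (m : ℤ) ∣ (a : ℤ) - b := by
  have := (ZMod.intCast_eq_intCast_iff_dvd_sub (b : ℤ) (a : ℤ) m).1 (by push_cast; exact h.symm)
  exact this

lemma exists_split (V : Multiset G) (h : G) : ∃ T : Multiset G, V = V.count h • {h} + T ∧
    ∀ g ∈ T, g ∈ V ∧ g ≠ h := by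
  refine ⟨V.filter (fun g => ¬ (g = h)), ?_, fun g hg => Multiset.mem_filter.1 hg⟩
  rw [Multiset.nsmul_singleton, ← Multiset.filter_eq', Multiset.filter_add_not]

variable [Fintype G]

lemma st_A1 {n : ℕ} (hn : 4 ≤ n) (hexp : ∀ g : G, n • g = 0) {G0 : Set G} {h : G}
    (hm : -h ∈ G0) {t : Finset G} (htG : ∀ g ∈ t, g ∈ G0)
    (hm' : -h ∉ t) (hP : PP h t) :
    ∃ (c : ℕ) (T : Multiset G), 1 ≤ c ∧ c < n ∧ (∀ g ∈ T, g ∈ t) ∧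
      IsMinZeroSum G0 (c • {-h} + T) := by
  obtain ⟨y, a, ha, hy⟩ := hP
  set a' := (a % n).toNat with ha'
  have ha1 : a' • h = a • h := nat_of_int (by omega) hexp a h
  have ha2 : a' < n := by
    have := Int.emod_lt_of_pos a (b := n) (by omega)
    omega
  have ha0 : a' ≠ 0 := by
    intro h0
    rw [h0, zero_smul] at ha1
    exact ha ha1.symm
  set B := a' • {-h} + seqOf t (fun g => (y g % n).toNat) with hB
  have hB0 : IsZeroSumSeq G0 B := by
    constructor
    · intro g hg
      rw [hB, Multiset.mem_add] at hg
      rcases hg with hg | hg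
      · rw [Multiset.nsmul_singleton] at hg
        rw [Multiset.eq_of_mem_replicate hg]
        exact hm
      · exact htG g (mem_seqOf hg)
    · rw [hB, Multiset.sum_add, sum_seqOf, Multiset.sum_nsmul, Multiset.sum_singleton]
      simp only [nat_of_int (show 0 < n by omega) hexp]
      rw [hy, smul_neg, ha1]
      simp
  obtain ⟨F, hF, hFB⟩ := hB0.exists_fac
  have hmem : -h ∈ F.sum := by
    rw [hFB, hB, Multiset.mem_add, Multiset.nsmul_singleton]
    left
    exact Multiset.mem_replicate.2 ⟨ha0, rfl⟩
  have hex : ∃ U ∈ F, -h ∈ U := by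
    by_contra hno
    push Not at hno
    have := fac_count_sum F (-h)
    rw [Multiset.sum_eq_zero (s := F.map _)] at this
    · exact Multiset.count_ne_zero.2 hmem this
    · intro x hx
      obtain ⟨V, hV, rfl⟩ := Multiset.mem_map.1 hx
      exact Multiset.count_eq_zero.2 (hno V hV)
  obtain ⟨U, hU, hhU⟩ := hex
  have hUB : U ≤ B := hFB ▸ le_sum_of_mem hU
  refine ⟨U.count (-h), U.filter (fun g => ¬ (g = -h)), Multiset.count_pos.2 hhU, ?_, ?_, ?_⟩
  · refine (Multiset.count_le_of_le _ hUB).trans_lt ?_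
    rw [hB, Multiset.count_add, count_seqOf, if_neg hm', Multiset.count_nsmul]
    simpa using ha2
  · intro g hg
    obtain ⟨hg1, hg2⟩ := Multiset.mem_filter.1 hg
    have := Multiset.mem_of_le hUB hg1
    rw [hB, Multiset.mem_add, Multiset.nsmul_singleton] at this
    rcases this with h1 | h1
    · exact absurd (Multiset.eq_of_mem_replicate h1) hg2
    · exact mem_seqOf h1
  · rw [Multiset.nsmul_singleton, ← Multiset.filter_eq', Multiset.filter_add_not]
    exact hF U hU

lemma st_A2 {n : ℕ} (hn : 4 ≤ n) (hexp : ∀ g : G, n • g = 0) {G0 : Set G} (hc : Cong G0 (n - 2))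
    {h : G} (hp : h ∈ G0) (hm : -h ∈ G0) (hord : addOrderOf h = n) {t : Finset G}
    (htG : ∀ g ∈ t, g ∈ G0) (hp' : h ∉ t) (hm' : -h ∉ t) (hP : PP h t) :
    ∃ h', (h' = h ∨ h' = -h) ∧ ∃ T : Multiset G, (∀ g ∈ T, g ∈ t) ∧
      IsMinZeroSum G0 ({-h'} + T) := by
  obtain ⟨c, T, hc1, hcn, hT, hU⟩ := st_A1 hn hexp hm htG hm' hP
  by_cases hc2 : c = 1
  · refine ⟨h, Or.inl rfl, T, hT, ?_⟩
    simpa [hc2] using hU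
  have hh0 : h ≠ 0 := by
    rintro rfl
    simp at hord
    omega
  set Z := T + (n - c) • {h} with hZ
  have hTs : T.sum = c • h := by
    have := hU.2.2.1
    rw [Multiset.sum_add, Multiset.sum_nsmul, Multiset.sum_singleton, smul_neg] at this
    exact (neg_add_eq_zero.1 this).symm
  have hZ0 : IsZeroSumSeq G0 Z := by
    constructor
    · intro g hg
      rw [hZ, Multiset.mem_add, Multiset.nsmul_singleton] at hg
      rcases hg with hg | hg
      · exact htG g (hT g hg)
      · rw [Multiset.eq_of_mem_replicate hg]; exact hp
    · rw [hZ, Multiset.sum_add, Multiset.sum_nsmul, Multiset.sum_singleton, hTs, ← add_smul,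
        Nat.add_sub_cancel' hcn.le, hexp]
  have hn_at : IsMinZeroSum G0 (n • {h}) := by
    have := atom_ord (G0 := G0) hp
    rwa [hord] at this
  have hpair := atom_pair hp hm hh0
  have heq : (c • {-h} + T) + n • {h} = c • ({h} + {-h}) + Z := by
    rw [hZ, smul_add, ← Nat.add_sub_cancel' hcn.le, add_smul, Nat.add_sub_cancel' hcn.le]
    abel
  have hl := congrArg (lam G0 (n-2)) heq
  rw [lam_add hc hU.zs hn_at.zs, lam_add hc (hpair.zs.nsmul c) hZ0, lam_nsmul hc hpair.zs,
    lam_atom hc hU, lam_atom hc hn_at, lam_atom hc hpair] at hl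
  obtain ⟨F, hF, hFZ⟩ := hZ0.exists_fac
  rw [← hFZ, lam_fac hc hF] at hl
  have hcont : ∀ V ∈ F, 1 ≤ V.count h := by
    intro V hV
    by_contra hlt
    have h0 : V.count h = 0 := by omega
    have hVZ : V ≤ Z := hFZ ▸ le_sum_of_mem hV
    have hVT : V ≤ T := by
      rw [Multiset.le_iff_count]
      intro g
      by_cases hg : g = h
      · subst hg; omega
      · have := Multiset.count_le_of_le g hVZ
        rw [hZ, Multiset.count_add, Multiset.count_nsmul, Multiset.count_singleton, if_neg hg] at this
        simpa using this
    have hVU : V = c • {-h} + T := hU.eq_of_le (hVT.trans (Multiset.le_add_left _ _)) (hF V hV).2.2.1 (hF V hV).1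
    have : -h ∈ V := by
      rw [hVU, Multiset.mem_add, Multiset.nsmul_singleton]
      left
      exact Multiset.mem_replicate.2 ⟨by omega, rfl⟩
    exact hm' (hT _ (Multiset.mem_of_le hVT this))
  have hcount : Z.count h = n - c := by
    rw [hZ, Multiset.count_add, Multiset.count_nsmul, Multiset.count_eq_zero.2 (fun hh => hp' (hT _ hh))]
    simp
  have hle := fac_count_ge F h 1 hcont
  rw [hFZ, hcount] at hle
  have hF0 : Multiset.card F ≠ 0 := by
    intro h0
    rw [Multiset.card_eq_zero] at h0
    rw [h0, Multiset.sum_zero] at hFZ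
    rw [← hFZ] at hcount
    simp at hcount
    omega
  have hdv : ((n - 2 : ℕ) : ℤ) ∣ ((Multiset.card F + c : ℕ) : ℤ) - (n : ℕ) := by
    apply zmod_eq_of_lt
    have : (n : ZMod (n-2)) = 2 := by
      have h2 : ((n - 2 + 2 : ℕ) : ZMod (n-2)) = 2 := by push_cast [ZMod.natCast_self]; simp
      rwa [Nat.sub_add_cancel (by omega)] at h2
    rw [this]
    push_cast
    linear_combination -hl
  have hFc : Multiset.card F = n - c := by
    have := Int.eq_zero_of_abs_lt_dvd hdv (by rw [abs_lt]; constructor <;> omega)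
    omega
  have hone := fac_count_eq F h hcont (by rw [hFZ, hcount, hFc])
  obtain ⟨V, hV⟩ := Multiset.exists_mem_of_ne_zero (s := F) (fun h0 => hF0 (by simp [h0]))
  obtain ⟨T', hT', hTm⟩ := exists_split V h
  rw [hone V hV, one_smul] at hT'
  refine ⟨-h, Or.inr rfl, T', ?_, ?_⟩
  · intro g hg
    obtain ⟨hg1, hg2⟩ := hTm g hg
    have := Multiset.mem_of_le (hFZ ▸ le_sum_of_mem hV : V ≤ Z) hg1
    rw [hZ, Multiset.mem_add, Multiset.nsmul_singleton] at this
    rcases this with h1 | h1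
    · exact hT g h1
    · exact absurd (Multiset.eq_of_mem_replicate h1) hg2
  · rw [neg_neg, ← hT']
    exact hF V hV
end ST


end Part4

section Part5

set_option linter.unusedSectionVars false

section ST2
variable {G : Type*} [AddCommGroup G] 

lemma st_A3 {n : ℕ} (hn : 4 ≤ n) (hexp : ∀ g : G, n • g = 0)
    {h : G} (hord : addOrderOf h = n) {t : Finset G}
    (hmin : ∀ s, s ⊂ t → ¬ PP h s) {v : G → ℕ} (hv : ∑ g ∈ t, v g • g = h) :
    IndepN n t ∧ ∀ g ∈ t, Nat.Coprime (v g) n := by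
  have M : ∀ (z : G → ℤ) (x : ℤ), ∑ g ∈ t, z g • g = x • h → ∀ g ∈ t, z g • g = 0 →
      (n : ℤ) ∣ x := by
    intro z x hz g hg hg0
    rw [← hord, addOrderOf_dvd_iff_zsmul_eq_zero]
    by_contra hne
    refine hmin (t.erase g) (Finset.erase_ssubset hg) ⟨z, x, hne, ?_⟩
    rw [← hz, ← Finset.add_sum_erase t _ hg, hg0, zero_add]
  have hvz : ∀ x : ℤ, ∑ g ∈ t, (x * v g) • g = x • h := by
    intro x
    rw [← hv, Finset.smul_sum]
    refine Finset.sum_congr rfl fun g _ => ?_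
    rw [mul_smul, natCast_zsmul]
  have hexpz : ∀ (m : ℤ) (g : G), ((n : ℤ) * m) • g = 0 := by
    intro m g
    rw [mul_comm, mul_smul, natCast_zsmul, hexp, smul_zero]
  have hcop : ∀ g ∈ t, Nat.Coprime (v g) n := by
    intro g hg
    set e := Nat.gcd (v g) n with he
    obtain ⟨a, ha⟩ : e ∣ v g := Nat.gcd_dvd_left _ _
    obtain ⟨b, hb⟩ : e ∣ n := Nat.gcd_dvd_right _ _
    have h1 := M (fun x => (b : ℤ) * v x) b (hvz b) g hg (by
      have : (b : ℤ) * v g = n * a := by rw [ha, hb]; push_cast; ring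
      show ((b : ℤ) * v g) • g = 0
      rw [this, hexpz])
    have h2 : n ∣ b := Int.natCast_dvd_natCast.1 h1
    have hb0 : 0 < b := Nat.pos_of_ne_zero (by rintro rfl; simp at hb; omega)
    have := Nat.le_of_dvd hb0 h2
    have he0 : 0 < e := Nat.pos_of_ne_zero (by intro h0; rw [h0] at hb; simp at hb; omega)
    show e = 1
    nlinarith
  refine ⟨?_, hcop⟩
  intro y hy g hg
  have hc : IsCoprime (v g : ℤ) (n : ℤ) := Nat.isCoprime_iff_coprime.2 (hcop g hg)
  obtain ⟨u, w, huw⟩ := hc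
  set x := y g * u with hx
  have h1 := M (fun k => x * v k - y k) x (by
    simp only [sub_smul, Finset.sum_sub_distrib, hy, hvz, sub_zero]) g hg (by
      have : x * v g - y g = n * (- (y g * w)) := by
        rw [hx]; linear_combination y g * huw
      show (x * v g - y g) • g = 0
      rw [this, hexpz])
  obtain ⟨m, hm⟩ := h1
  refine ⟨m * v g + y g * w, ?_⟩
  have : x * v g = n * m * v g := by rw [hm]
  rw [hx] at this
  linear_combination (-y g) * huw + this

variable [Fintype G]

/-- Part C of the structure theorem. -/
lemma st_C {n : ℕ} (hn : 4 ≤ n) (hexp : ∀ g : G, n • g = 0) {G0 : Set G} (hc : Cong G0 (n - 2))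
    {u : G} (hp : u ∈ G0) (hm : -u ∈ G0) (hu0 : u ≠ 0) {t : Finset G}
    (htG : ∀ g ∈ t, g ∈ G0) (hp' : u ∉ t) (hm' : -u ∉ t) (hi : IndepN n t) {v : G → ℕ}
    (hv : ∑ g ∈ t, v g • g = -u) (hcop : ∀ g ∈ t, Nat.Coprime (v g) n)
    (hvn : ∀ g ∈ t, v g < n) (hcard : (t.card : ZMod (n-2)) = 1)
    (hex : ∃ g ∈ t, 2 ≤ v g) : ∀ g ∈ t, 2 * (n - v g) < n := by
  have hvz : ∑ g ∈ t, ((v g : ℕ) : ℤ) • g = -u := by simpa using hv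
  have hvz' : ∑ g ∈ t, (-(v g : ℕ) : ℤ) • g = -(-u) := by simp [hv]
  obtain ⟨g1, hg1, hg1v⟩ := hex
  have hexc : ∃ c, ∃ g ∈ t, n ≤ c * v g := ⟨n, g1, hg1, by nlinarith⟩
  set c := Nat.find hexc with hcdef
  obtain ⟨g2, hg2, hg2v⟩ := Nat.find_spec hexc
  rw [← hcdef] at hg2v
  have hmin : ∀ j < c, ∀ g ∈ t, j * v g < n := by
    intro j hj g hg
    have := Nat.find_min hexc hj
    push Not at this
    exact this g hg
  have hc2 : 2 ≤ c := by
    by_contra hlt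
    have h3 := hvn g2 hg2
    have : c ≤ 1 := by omega
    nlinarith
  have hcn : c ≤ n - 1 := by
    refine Nat.find_min' hexc ⟨g1, hg1, ?_⟩
    obtain ⟨m, rfl⟩ : ∃ m, n = m + 4 := ⟨n - 4, by omega⟩
    simp only [show m + 4 - 1 = m + 3 from rfl]
    nlinarith
  have hpos : ∀ g ∈ t, 0 < c * v g % n := by
    intro g hg
    rw [Nat.pos_iff_ne_zero]
    intro h0
    have h1 : n ∣ c * v g := Nat.dvd_of_mod_eq_zero h0
    have h2 : n ∣ c := (hcop g hg).symm.dvd_of_dvd_mul_right h1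
    have := Nat.le_of_dvd (by omega) h2
    omega
  -- X_c
  set X := c • {u} + seqOf t (fun g => c * v g % n) with hX
  have hXu : X.count u = c := by
    rw [hX, Multiset.count_add, count_seqOf, if_neg hp', Multiset.count_nsmul]; simp
  have hXg : ∀ g ∈ t, X.count g = c * v g % n := by
    intro g hg
    rw [hX, Multiset.count_add, count_seqOf, if_pos hg, Multiset.count_nsmul,
      Multiset.count_singleton, if_neg (fun h : g = u => hp' (h ▸ hg))]; simp
  have hXs : ∀ g ∈ X, g = u ∨ g ∈ t := by
    intro g hg
    rw [hX, Multiset.mem_add, Multiset.nsmul_singleton] at hg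
    exact hg.imp Multiset.eq_of_mem_replicate mem_seqOf
  have hX0 : X.sum = 0 := by
    refine zs_of_dvd hexp hp' hvz hXs fun g hg => ?_
    rw [hXu, hXg g hg]
    push_cast
    refine ⟨-((c * v g : ℤ) / n), ?_⟩
    linear_combination -(Int.emod_add_mul_ediv (c * v g : ℤ) n) + 2 * Int.emod_add_mul_ediv (c * v g : ℤ) n
  have hXG : ∀ g ∈ X, g ∈ G0 := fun g hg => by
    rcases hXs g hg with rfl | h
    · exact hp
    · exact htG g h
  have hXlt : ∀ g ∈ t, X.count g < n := fun g hg => by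
    rw [hXg g hg]; exact Nat.mod_lt _ (by omega)
  have hcntT : ∀ T ≤ X, T.sum = 0 → T.count u < c → T.count g2 = T.count u * v g2 := by
    intro T hT hT0 hj
    have h1 := zs_dvd hi hp' hvz (fun g hg => hXs g (Multiset.mem_of_le hT hg)) hT0 g2 hg2
    have h2 := hmin _ hj g2 hg2
    have h3 : T.count g2 < n := (Multiset.count_le_of_le g2 hT).trans_lt (hXlt g2 hg2)
    have h4 := Int.eq_zero_of_abs_lt_dvd h1 (by
      rw [abs_lt]
      zify at h2 h3
      have : (0:ℤ) ≤ T.count u * v g2 := by positivity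
      constructor <;> omega)
    zify
    omega
  have hXat : IsMinZeroSum G0 X := by
    refine ⟨fun h0 => by rw [h0] at hXu; simp at hXu; omega, hXG, hX0, fun T hT hT0 => ?_⟩
    have hcT := Multiset.count_le_of_le u hT
    rw [hXu] at hcT
    have hT' := sub_zs hT hX0 hT0
    have hle' : X - T ≤ X := Multiset.sub_le_self _ _
    have hcs : ∀ g, (X - T).count g = X.count g - T.count g := fun g => Multiset.count_sub _ _ _
    rcases Nat.eq_zero_or_pos (T.count u) with hz | hz
    · left
      exact eq_zero_of_no_u hi hp' hvz (fun g hg => hXs g (Multiset.mem_of_le hT hg)) hT0 hz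
        (fun g hg => (Multiset.count_le_of_le g hT).trans_lt (hXlt g hg))
    · rcases hcT.eq_or_lt with hz' | hz'
      · right
        have : X - T = 0 := eq_zero_of_no_u hi hp' hvz
          (fun g hg => hXs g (Multiset.mem_of_le hle' hg)) hT' (by rw [hcs, hXu, hz']; simp)
          (fun g hg => (Multiset.count_le_of_le g hle').trans_lt (hXlt g hg))
        exact le_antisymm hT (tsub_eq_zero_iff_le.1 this)
      · exfalso
        have h1 := hcntT T hT hT0 hz'
        have h2 := hcntT (X - T) hle' hT' (by rw [hcs, hXu]; omega)
        rw [hcs, hcs, hXu, h1, hXg g2 hg2] at h2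
        have h3 := Multiset.count_le_of_le g2 hT
        rw [h1, hXg g2 hg2] at h3
        have h4 : c * v g2 % n < n := Nat.mod_lt _ (by omega)
        have h5 : (c - T.count u) * v g2 + T.count u * v g2 = c * v g2 := by
          rw [← Nat.add_mul]; congr 1; omega
        omega
  -- W_c
  set W := c • {-u} + seqOf t (fun g => n - c * v g % n) with hW
  have hWu : W.count (-u) = c := by
    rw [hW, Multiset.count_add, count_seqOf, if_neg hm', Multiset.count_nsmul]; simp
  have hWg : ∀ g ∈ t, W.count g = n - c * v g % n := by
    intro g hg
    rw [hW, Multiset.count_add, count_seqOf, if_pos hg, Multiset.count_nsmul,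
      Multiset.count_singleton, if_neg (fun h : g = -u => hm' (h ▸ hg))]; simp
  have hWs : ∀ g ∈ W, g = -u ∨ g ∈ t := by
    intro g hg
    rw [hW, Multiset.mem_add, Multiset.nsmul_singleton] at hg
    exact hg.imp Multiset.eq_of_mem_replicate mem_seqOf
  have hpair := atom_pair hp hm hu0
  have hnat : ∀ g ∈ t, IsMinZeroSum G0 (n • {g}) := fun g hg => by
    have := atom_ord (G0 := G0) (htG g hg)
    rwa [indep_exp_addOrderOf hexp hi hg] at this
  have hsum : X + W = c • ({u} + {-u}) + ∑ g ∈ t, n • ({g} : Multiset G) := by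
    have : seqOf t (fun g => c * v g % n) + seqOf t (fun g => n - c * v g % n)
        = ∑ g ∈ t, n • ({g} : Multiset G) := by
      unfold seqOf
      rw [← Finset.sum_add_distrib]
      refine Finset.sum_congr rfl fun g _ => ?_
      rw [← add_smul, Nat.add_sub_cancel' (Nat.mod_lt _ (by omega)).le]
    rw [hX, hW, ← this, smul_add]
    abel
  obtain ⟨hz, hlz⟩ := lam_sum_atoms hc t _ hnat
  have hWz : IsZeroSumSeq G0 W := by
    constructor
    · intro g hg
      rcases hWs g hg with rfl | h
      · exact hm
      · exact htG g h
    · have h1 := congrArg Multiset.sum hsum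
      rw [Multiset.sum_add X W, hX0, zero_add] at h1
      rw [h1, Multiset.sum_add, Multiset.sum_nsmul, hz.2, hpair.2.2.1]
      simp
  have hl := congrArg (lam G0 (n-2)) hsum
  rw [lam_add hc hXat.zs hWz, lam_add hc (hpair.zs.nsmul c) hz, lam_nsmul hc hpair.zs,
    lam_atom hc hXat, lam_atom hc hpair, hlz, hcard] at hl
  obtain ⟨F, hF, hFW⟩ := hWz.exists_fac
  rw [← hFW, lam_fac hc hF] at hl
  have hVs : ∀ V ∈ F, ∀ g ∈ V, g = -u ∨ g ∈ t := fun V hV g hg =>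
    hWs g (Multiset.mem_of_le (hFW ▸ le_sum_of_mem hV) hg)
  have hVle : ∀ V ∈ F, V ≤ W := fun V hV => hFW ▸ le_sum_of_mem hV
  have hcont : ∀ V ∈ F, 1 ≤ V.count (-u) := by
    intro V hV
    by_contra hlt
    refine (hF V hV).1 (eq_zero_of_no_u hi hm' hvz' (hVs V hV) (hF V hV).2.2.1 (by omega) ?_)
    intro g hg
    refine (Multiset.count_le_of_le g (hVle V hV)).trans_lt ?_
    rw [hWg g hg]
    have := hpos g hg
    omega
  have hle := fac_count_ge F (-u) 1 hcont
  rw [hFW, hWu] at hle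
  have hF0 : Multiset.card F ≠ 0 := by
    intro h0
    rw [Multiset.card_eq_zero] at h0
    rw [h0, Multiset.sum_zero] at hFW
    rw [← hFW] at hWu
    simp at hWu
    omega
  have hdv : ((n - 2 : ℕ) : ℤ) ∣ ((c : ℕ) : ℤ) - Multiset.card F := by
    apply zmod_eq_of_lt
    linear_combination -hl
  have hFc : Multiset.card F = c := by
    have hlt : c < n - 1 := by
      by_contra hge
      have h1 := hmin (n - 2) (by omega) g1 hg1
      obtain ⟨m, rfl⟩ : ∃ m, n = m + 4 := ⟨n - 4, by omega⟩
      simp only [show m + 4 - 2 = m + 2 from rfl] at h1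
      nlinarith
    have := Int.eq_zero_of_abs_lt_dvd hdv (by rw [abs_lt]; constructor <;> omega)
    omega
  have hone := fac_count_eq F (-u) hcont (by rw [hFW, hWu, hFc])
  intro g hg
  have hge : ∀ V ∈ F, n - v g ≤ V.count g := by
    intro V hV
    have h1 := zs_dvd hi hm' hvz' (hVs V hV) (hF V hV).2.2.1 g hg
    rw [hone V hV] at h1
    by_contra hlt
    have h2 := hvn g hg
    have hv0 : 0 < v g := Nat.pos_of_ne_zero (by
      intro h0; have := hcop g hg; rw [h0] at this; simp at this; omega)
    have := Int.eq_zero_of_abs_lt_dvd h1 (by rw [abs_lt]; push_cast; constructor <;> omega)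
    push_cast at this
    omega
  have h3 := fac_count_ge F g _ hge
  rw [hFW, hWg g hg, hFc] at h3
  have := hpos g hg
  have h4 : (n - v g) * 2 ≤ (n - v g) * c := Nat.mul_le_mul_left _ hc2
  omega
end ST2


end Part5

section Part6

set_option linter.unusedSectionVars false

section ST3
variable {G : Type*} [AddCommGroup G] [Fintype G]

lemma cast_n_zmod {n : ℕ} (hn : 4 ≤ n) : (n : ZMod (n-2)) = 2 := by
  have h2 : ((n - 2 + 2 : ℕ) : ZMod (n-2)) = 2 := by push_cast [ZMod.natCast_self]; simp
  rwa [Nat.sub_add_cancel (by omega)] at h2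

lemma st_main_aux {n : ℕ} (hn : 4 ≤ n) (hexp : ∀ g : G, n • g = 0)
    (hcG : Fintype.card G ≤ n ^ (n - 1)) {G0 : Set G} (hc : Cong G0 (n - 2))
    {h : G} (hp : h ∈ G0) (hm : -h ∈ G0) (hord : addOrderOf h = n) {t : Finset G}
    (htG : ∀ g ∈ t, g ∈ G0) (hp' : h ∉ t) (hm' : -h ∉ t)
    (hmin : ∀ s, s ⊂ t → ¬ PP h s) {T : Multiset G} (hT : ∀ g ∈ T, g ∈ t)
    (hX : IsMinZeroSum G0 ({-h} + T)) :
    t.card = n - 1 ∧ IndepN n t ∧ (h = ∑ g ∈ t, g ∨ h = -∑ g ∈ t, g) := by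
  have hh0 : h ≠ 0 := by
    rintro rfl
    simp at hord
    omega
  set v : G → ℕ := fun g => T.count g with hvdef
  have hTsum : T.sum = h := by
    have := hX.2.2.1
    rw [Multiset.sum_add, Multiset.sum_singleton] at this
    exact (neg_add_eq_zero.1 this).symm
  have hv : ∑ g ∈ t, v g • g = h := by
    rw [← hTsum]; exact (sum_of_supp T t hT).symm
  obtain ⟨hi, hcop⟩ := st_A3 hn hexp hord hmin hv
  have hv0 : ∀ g ∈ t, 0 < v g := fun g hg => Nat.pos_of_ne_zero (by
      intro h0; have := hcop g hg; rw [h0] at this; simp at this; omega)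
  have hvn : ∀ g ∈ t, v g < n := by
    intro g hg
    have h1 := atom_count_le hX g
    rw [indep_exp_addOrderOf hexp hi hg] at h1
    have h2 : v g ≤ n := by
      refine le_trans ?_ h1
      rw [Multiset.count_add]; simp [hvdef]
    rcases h2.lt_or_eq with h3 | h3
    · exact h3
    · have := hcop g hg
      rw [h3] at this
      simp at this
      omega
  have hvz' : ∑ g ∈ t, (-(v g : ℕ) : ℤ) • g = -h := by simp [hv]
  have hT' : T = seqOf t v := by
    ext g
    rw [count_seqOf]
    split_ifs with hg
    · rfl
    · exact Multiset.count_eq_zero.2 (fun hh => hg (hT g hh))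
  -- W
  set W := {h} + seqOf t (fun g => n - v g) with hW
  have hnat : ∀ g ∈ t, IsMinZeroSum G0 (n • {g}) := fun g hg => by
    have := atom_ord (G0 := G0) (htG g hg)
    rwa [indep_exp_addOrderOf hexp hi hg] at this
  obtain ⟨hz, hlz⟩ := lam_sum_atoms hc t _ hnat
  have hpair := atom_pair hp hm hh0
  have hsum : ({-h} + T) + W = ({h} + {-h}) + ∑ g ∈ t, n • ({g} : Multiset G) := by
    have : seqOf t v + seqOf t (fun g => n - v g) = ∑ g ∈ t, n • ({g} : Multiset G) := by
      unfold seqOf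
      rw [← Finset.sum_add_distrib]
      refine Finset.sum_congr rfl fun g hg => ?_
      rw [← add_smul, Nat.add_sub_cancel' (hvn g hg).le]
    rw [hT', hW, ← this]
    abel
  have hWs : ∀ g ∈ W, g = h ∨ g ∈ t := by
    intro g hg
    rw [hW, Multiset.mem_add, Multiset.mem_singleton] at hg
    exact hg.imp id mem_seqOf
  have hWz : W.sum = 0 := by
    have h1 := congrArg Multiset.sum hsum
    rw [Multiset.sum_add ({-h} + T) W, hX.2.2.1, zero_add] at h1
    rw [h1, Multiset.sum_add, hz.2, hpair.2.2.1]
    simp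
  have hWat : IsMinZeroSum G0 W := by
    refine atom_one hi hp' hvz' hWs ?_ hWz ?_ ?_
    · intro g hg
      rcases hWs g hg with rfl | hg
      · exact hp
      · exact htG g hg
    · rw [hW, Multiset.count_add, count_seqOf, if_neg hp']; simp
    · intro g hg
      rw [hW, Multiset.count_add, count_seqOf, if_pos hg, Multiset.count_singleton,
        if_neg (fun hh : g = h => hp' (hh ▸ hg))]
      have := hv0 g hg
      omega
  have hl := congrArg (lam G0 (n-2)) hsum
  rw [lam_add hc hX.zs hWat.zs, lam_add hc hpair.zs hz, lam_atom hc hX, lam_atom hc hWat,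
    lam_atom hc hpair, hlz] at hl
  have hcard : (t.card : ZMod (n-2)) = 1 := by linear_combination -hl
  have htn : t.card ≤ n - 1 := by
    have := (card_pow_le hi).trans hcG
    exact (Nat.pow_le_pow_iff_right (by omega)).1 this
  have ht0 : t.card ≠ 0 := by
    intro h0
    rw [Finset.card_eq_zero] at h0
    rw [h0] at hv
    simp at hv
    exact hh0 hv.symm
  have ht1 : t.card ≠ 1 := by
    intro h1
    obtain ⟨g, rfl⟩ := Finset.card_eq_one.1 h1
    have hg : g ∈ ({g} : Finset G) := Finset.mem_singleton_self g
    have hn_at : IsMinZeroSum G0 (n • {-h}) := by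
      have := atom_ord (G0 := G0) hm
      rwa [addOrderOf_neg, hord] at this
    have hs : n • ({-h} + T) = n • {-h} + v g • (n • {g}) := by
      rw [hT', smul_add]
      simp only [seqOf, Finset.sum_singleton]
      rw [smul_comm]
    have hl2 := congrArg (lam G0 (n-2)) hs
    rw [lam_nsmul hc hX.zs, lam_add hc hn_at.zs ((hnat g hg).zs.nsmul _), lam_nsmul hc (hnat g hg).zs,
      lam_atom hc hX, lam_atom hc hn_at, lam_atom hc (hnat g hg), cast_n_zmod hn] at hl2
    have hdv : ((n - 2 : ℕ) : ℤ) ∣ ((v g : ℕ) : ℤ) - (1 : ℕ) := by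
      apply zmod_eq_of_lt
      push_cast
      linear_combination -hl2
    have hvg : v g = 1 ∨ v g = n - 1 := by
      by_contra hno
      push Not at hno
      have h1 := hvn g hg
      have h2 := hv0 g hg
      have := Int.eq_zero_of_abs_lt_dvd hdv (by rw [abs_lt]; push_cast; constructor <;> omega)
      push_cast at this
      omega
    rw [Finset.sum_singleton] at hv
    rcases hvg with h1 | h1
    · rw [h1, one_smul] at hv
      exact hp' (hv ▸ hg)
    · have : (n - 1) • g + g = 0 := by
        rw [← succ_nsmul, Nat.sub_add_cancel (by omega), hexp]
      rw [← h1, hv] at this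
      rw [neg_eq_of_add_eq_zero_right this] at hm'
      exact hm' hg
  have htcard : t.card = n - 1 := by
    have hdv : ((n - 2 : ℕ) : ℤ) ∣ ((t.card : ℕ) : ℤ) - (1 : ℕ) := by
      apply zmod_eq_of_lt
      push_cast
      exact hcard
    by_contra hno
    have := Int.eq_zero_of_abs_lt_dvd hdv (by rw [abs_lt]; push_cast; constructor <;> omega)
    push_cast at this
    omega
  refine ⟨htcard, hi, ?_⟩
  have C1 := st_C hn hexp hc hm (by simpa using hp) (neg_ne_zero.2 hh0) htG hm' (by simpa using hp') hi
    (v := v) (by simpa using hv) hcop hvn hcard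
  have hvW : ∑ g ∈ t, (n - v g) • g = -h := by
    rw [← hv, eq_neg_iff_add_eq_zero, ← Finset.sum_add_distrib]
    refine Finset.sum_eq_zero fun g hg => ?_
    rw [← add_smul, Nat.sub_add_cancel (hvn g hg).le, hexp]
  have C2 := st_C hn hexp hc hp hm hh0 htG hp' hm' hi
    (v := fun g => n - v g) hvW (fun g hg => (Nat.coprime_self_sub_left (hvn g hg).le).2 (hcop g hg))
    (fun g hg => by have := hv0 g hg; show n - v g < n; omega) hcard
  obtain ⟨g0, hg0⟩ : t.Nonempty := Finset.card_ne_zero.1 ht0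
  by_cases e1 : ∃ g ∈ t, 2 ≤ v g
  · by_cases e2 : ∃ g ∈ t, 2 ≤ n - v g
    · have h1 := C1 e1 g0 hg0
      have h2 := C2 e2 g0 hg0
      have := hvn g0 hg0
      omega
    · right
      push Not at e2
      rw [← hv, eq_neg_iff_add_eq_zero, ← Finset.sum_add_distrib]
      refine Finset.sum_eq_zero fun g hg => ?_
      have h1 := e2 g hg
      have h2 := hvn g hg
      have : v g = n - 1 := by omega
      rw [this, ← succ_nsmul, Nat.sub_add_cancel (by omega), hexp]
  · left
    push Not at e1
    rw [← hv]
    refine Finset.sum_congr rfl fun g hg => ?_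
    have h1 := e1 g hg
    have h2 := hv0 g hg
    have : v g = 1 := by omega
    rw [this, one_smul]

theorem st_main {n : ℕ} (hn : 4 ≤ n) (hexp : ∀ g : G, n • g = 0)
    (hcG : Fintype.card G ≤ n ^ (n - 1)) {G0 : Set G} (hc : Cong G0 (n - 2))
    {h : G} (hp : h ∈ G0) (hm : -h ∈ G0) (hord : addOrderOf h = n) {t : Finset G}
    (htG : ∀ g ∈ t, g ∈ G0) (hp' : h ∉ t) (hm' : -h ∉ t)
    (hmin : ∀ s, s ⊂ t → ¬ PP h s) (hP : PP h t) :
    t.card = n - 1 ∧ IndepN n t ∧ (h = ∑ g ∈ t, g ∨ h = -∑ g ∈ t, g) := by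
  obtain ⟨h', hh', T, hT, hX⟩ := st_A2 hn hexp hc hp hm hord htG hp' hm' hP
  rcases hh' with rfl | rfl
  · exact st_main_aux hn hexp hcG hc hp hm hord htG hp' hm' hmin hT hX
  · obtain ⟨h1, h2, h3⟩ := st_main_aux hn hexp hcG hc hm (by simpa using hp)
      (by rwa [addOrderOf_neg]) htG hm' (by simpa using hp')
      (fun s hs => by rw [PP_neg_iff]; exact hmin s hs) hT hX
    refine ⟨h1, h2, ?_⟩
    rcases h3 with h3 | h3
    · right; rw [← h3, neg_neg]
    · left; exact neg_injective h3
end ST3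


end Part6

section Part7

set_option linter.unusedSectionVars false

section Conn
variable {G : Type*} [AddCommGroup G] 

lemma wt_seqOf {M : Type*} [AddCommMonoid M] (w : G → M) (t : Finset G) (y : G → ℕ) :
    wt w (seqOf t y) = ∑ g ∈ t, y g • w g := by
  unfold seqOf
  induction t using Finset.induction_on with
  | empty => simp [wt_zero]
  | insert a s ha ih =>
    rw [Finset.sum_insert ha, wt_add, ih, Finset.sum_insert ha, wt_nsmul, wt_singleton]

lemma exists_min_PP {h : G} {s : Finset G} (hP : PP h s) :
    ∃ s' ⊆ s, PP h s' ∧ ∀ q, q ⊂ s' → ¬ PP h q := by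
  obtain ⟨m, hm, hmin⟩ := exists_minimal_le_of_wellFoundedLT (PP h) s hP
  exact ⟨m, hm, hmin.prop, fun q hq hPq => hq.2 (hmin.le_of_le hPq hq.1)⟩

lemma split_le {U : Multiset G} {u : G} {t : Finset G} (hu : u ∉ t) {x : ℕ} {y : G → ℕ}
    (hx : x ≤ U.count u) (hy : ∀ g ∈ t, y g ≤ U.count g) : x • {u} + seqOf t y ≤ U := by
  rw [Multiset.le_iff_count]
  intro g
  rw [Multiset.count_add, count_seqOf, Multiset.count_nsmul, Multiset.count_singleton]
  by_cases hg : g ∈ t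
  · rw [if_pos hg, if_neg (fun h : g = u => hu (h ▸ hg))]
    simpa using hy g hg
  · rw [if_neg hg]
    split_ifs with h1
    · subst h1; simpa using hx
    · simp

lemma nsmul_le_of_count {U : Multiset G} {g : G} {n : ℕ} (h : n ≤ U.count g) : n • {g} ≤ U := by
  rw [Multiset.nsmul_singleton]
  exact Multiset.le_count_iff_replicate_le.1 h

/-- Classification of atoms over `{0, h, -h} ∪ t` with `h = ∑ t`. -/
lemma atom_class {n : ℕ} (hn : 4 ≤ n) (hexp : ∀ g : G, n • g = 0) {G0 : Set G} {t : Finset G}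
    (hi : IndepN n t) {h : G} (hh : h = ∑ g ∈ t, g) (hp' : h ∉ t) (hm' : -h ∉ t)
    {U : Multiset G} (hU : IsMinZeroSum G0 U) (hs : ∀ g ∈ U, g = 0 ∨ g = h ∨ g = -h ∨ g ∈ t) :
    U = {0} ∨ U = {h} + {-h} ∨ (∃ g ∈ t, U = n • {g}) ∨ U = n • {h} ∨ U = n • {-h} ∨
    U = {-h} + seqOf t (fun _ => 1) ∨
    ∃ x : ℕ, 1 ≤ x ∧ x < n ∧ U = x • {h} + seqOf t (fun _ => n - x) := by
  have hsing : ∀ (g : G), n ≤ U.count g → U = n • {g} := by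
    intro g hg
    refine (hU.eq_of_le (nsmul_le_of_count hg) ?_ ?_).symm
    · simp [Multiset.sum_nsmul, hexp]
    · rw [Multiset.nsmul_singleton]
      intro h0
      have := congrArg Multiset.card h0
      simp at this
      omega
  by_cases h0 : (0 : G) ∈ U
  · left
    exact (hU.eq_of_le (Multiset.singleton_le.2 h0) (by simp) (by simp)).symm
  right
  by_cases hp : h ∈ U
  · by_cases hm : -h ∈ U
    · by_cases hhm : h = -h
      · by_cases h2 : 2 ≤ U.count h
        · left
          refine (hU.eq_of_le ?_ (by simp) (by simp)).symm
          rw [← hhm, ← two_nsmul]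
          exact nsmul_le_of_count h2
        · have hc1 : U.count h = 1 := by
            have := Multiset.count_pos.2 hp
            omega
          right; right; right; right; left
          have hv : ∑ g ∈ t, (1 : ℤ) • g = -(-h) := by simp [hh]
          have hs' : ∀ g ∈ U, g = -h ∨ g ∈ t := by
            intro g hg
            rcases hs g hg with rfl | rfl | rfl | h1
            · exact absurd hg h0
            · exact Or.inl hhm
            · exact Or.inl rfl
            · exact Or.inr h1
          have hd := zs_dvd hi hm' hv hs' hU.2.2.1
          rw [← hhm, hc1] at hd
          rw [← hhm]
          have : 1 • {h} + seqOf t (fun _ => 1) ≤ U := by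
            refine split_le hp' hc1.ge fun g hg => ?_
            have := hd g hg
            by_contra hlt
            have h2 : U.count g = 0 := by omega
            rw [h2] at this
            have := Int.eq_zero_of_abs_lt_dvd this (by rw [abs_lt]; push_cast; constructor <;> omega)
            simp at this
          rw [one_smul] at this
          refine (hU.eq_of_le this ?_ (by simp)).symm
          rw [Multiset.sum_add, sum_seqOf]
          simp [← hh]
          exact add_eq_zero_iff_eq_neg.2 hhm
      · left
        refine (hU.eq_of_le ?_ (by simp) (by simp)).symm
        rw [Multiset.le_iff_count]
        intro g
        rw [Multiset.count_add, Multiset.count_singleton, Multiset.count_singleton]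
        have h1 := Multiset.count_pos.2 hp
        have h2 := Multiset.count_pos.2 hm
        split_ifs with e1 e2 e2
        · exact absurd (e1.symm.trans e2) hhm
        · subst e1; omega
        · subst e2; omega
        · omega
    · right; right
      have hs' : ∀ g ∈ U, g = h ∨ g ∈ t := by
        intro g hg
        rcases hs g hg with rfl | rfl | rfl | h1
        · exact absurd hg h0
        · exact Or.inl rfl
        · exact absurd hg hm
        · exact Or.inr h1
      have hv : ∑ g ∈ t, (-1 : ℤ) • g = -h := by rw [← Finset.smul_sum, ← hh, neg_one_smul]
      have hd := zs_dvd hi hp' hv hs' hU.2.2.1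
      by_cases hxn : n ≤ U.count h
      · left; exact hsing h hxn
      · right; right; right
        have hx := Multiset.count_pos.2 hp
        refine ⟨U.count h, hx, by omega, ?_⟩
        refine (hU.eq_of_le (split_le hp' le_rfl fun g hg => ?_) ?_ ?_).symm
        · by_contra hlt
          have := Int.eq_zero_of_abs_lt_dvd (hd g hg) (by rw [abs_lt]; push_cast; constructor <;> omega)
          omega
        · rw [Multiset.sum_add, sum_seqOf, ← Finset.smul_sum, ← hh, Multiset.sum_nsmul,
            Multiset.sum_singleton, ← add_smul, Nat.add_sub_cancel' (by omega), hexp]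
        · intro hz
          have := congrArg (Multiset.count h) hz
          rw [Multiset.count_add, Multiset.count_nsmul, Multiset.count_singleton_self,
            Multiset.count_zero] at this
          omega
  · have hs' : ∀ g ∈ U, g = -h ∨ g ∈ t := by
      intro g hg
      rcases hs g hg with rfl | rfl | rfl | h1
      · exact absurd hg h0
      · exact absurd hg hp
      · exact Or.inl rfl
      · exact Or.inr h1
    have hv : ∑ g ∈ t, (1 : ℤ) • g = -(-h) := by simp [hh]
    have hd := zs_dvd hi hm' hv hs' hU.2.2.1
    right
    by_cases hm : -h ∈ U
    · by_cases hxn : n ≤ U.count (-h)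
      · right; right; left; exact hsing _ hxn
      · right; right; right; left
        have hx := Multiset.count_pos.2 hm
        have : 1 • {-h} + seqOf t (fun _ => 1) ≤ U := by
          refine split_le hm' hx fun g hg => ?_
          have := hd g hg
          by_contra hlt
          have h2 : U.count g = 0 := by omega
          rw [h2] at this
          have := Int.eq_zero_of_abs_lt_dvd this (by rw [abs_lt]; push_cast; constructor <;> omega)
          push_cast at this
          omega
        rw [one_smul] at this
        refine (hU.eq_of_le this ?_ (by simp)).symm
        rw [Multiset.sum_add, sum_seqOf]
        simp [← hh]
    · left
      obtain ⟨g, hg⟩ := Multiset.exists_mem_of_ne_zero hU.1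
      have hgt : g ∈ t := by
        rcases hs' g hg with rfl | h1
        · exact absurd hg hm
        · exact h1
      refine ⟨g, hgt, hsing g ?_⟩
      have h1 := hd g hgt
      rw [Multiset.count_eq_zero.2 hm] at h1
      have h2 : n ∣ U.count g := by simpa [Int.natCast_dvd_natCast] using h1
      exact Nat.le_of_dvd (Multiset.count_pos.2 hg) h2

variable [Fintype G]

lemma indep_inj {n : ℕ} {t : Finset G} (hi : IndepN n t) :
    Function.Injective (fun (f : t → Fin n) => ∑ g : t, ((f g : ℕ)) • (g : G)) := by
  intro f f' hff
  have h1 : ∑ g ∈ t, (if hg : g ∈ t then ((f ⟨g, hg⟩ : ℕ) : ℤ) - (f' ⟨g, hg⟩ : ℕ) else 0) • g = 0 := by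
    rw [← Finset.sum_coe_sort]
    simp only [Finset.coe_mem, dite_true, Subtype.coe_eta, sub_smul, Finset.sum_sub_distrib,
      natCast_zsmul]
    simpa [sub_eq_zero] using hff
  funext ⟨g, hg⟩
  have h2 := hi _ h1 g hg
  rw [dif_pos hg] at h2
  have h3 := (f ⟨g, hg⟩).2
  have h4 := (f' ⟨g, hg⟩).2
  have := Int.eq_zero_of_abs_lt_dvd h2 (by rw [abs_lt]; constructor <;> omega)
  apply Fin.ext
  omega

lemma indep_span {n : ℕ} {t : Finset G} (hi : IndepN n t) (hc : Fintype.card G ≤ n ^ t.card) (x : G) :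
    ∃ y : G → ℤ, x = ∑ g ∈ t, y g • g := by
  have hb : Function.Bijective (fun (f : t → Fin n) => ∑ g : t, ((f g : ℕ)) • (g : G)) := by
    rw [Fintype.bijective_iff_injective_and_card]
    refine ⟨indep_inj hi, ?_⟩
    have := card_pow_le hi
    simp
    omega
  obtain ⟨f, hf⟩ := hb.2 x
  refine ⟨fun g => if hg : g ∈ t then ((f ⟨g, hg⟩ : ℕ) : ℤ) else 0, ?_⟩
  rw [← hf, ← Finset.sum_coe_sort]
  simp

lemma conn_sub {n : ℕ} (hn : 4 ≤ n) (hexp : ∀ g : G, n • g = 0)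
    (hcG : Fintype.card G ≤ n ^ (n - 1)) {G0 : Set G} (hc : Cong G0 (n - 2))
    {h : G} (hp : h ∈ G0) (hm : -h ∈ G0) (hord : addOrderOf h = n) {t : Finset G}
    (htG : ∀ g ∈ t, g ∈ G0) (hp' : h ∉ t) (hm' : -h ∉ t)
    (hcard : t.card = n - 1) (hi : IndepN n t) (hh : h = ∑ g ∈ t, g) :
    ∀ f ∈ G0, f = 0 ∨ f = h ∨ f = -h ∨ f ∈ t := by
  intro f hf
  by_contra hno
  push Not at hno
  obtain ⟨hf0, hfh, hfm, hft⟩ := hno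
  obtain ⟨y, hy⟩ := indep_span hi (hcard ▸ hcG) f
  have key : ∀ g ∈ t, ¬ (n : ℤ) ∣ y g → f = g - 2 • h := by
    intro g hg hng
    set s := insert f (t.erase g) with hs
    have hfe : f ∉ t.erase g := fun h1 => hft (Finset.mem_of_mem_erase h1)
    have hyf : f = y g • g + ∑ x ∈ t.erase g, y x • x := by
      rw [Finset.add_sum_erase t (fun x => y x • x) hg]; exact hy
    have hhg : h = g + ∑ x ∈ t.erase g, x := by
      rw [Finset.add_sum_erase t (fun x => x) hg]; exact hh
    have hP : PP h s := by
      refine ⟨fun x => if x = f then 1 else y g - y x, y g, ?_, ?_⟩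
      · rwa [Ne, ← addOrderOf_dvd_iff_zsmul_eq_zero, hord]
      · rw [hs, Finset.sum_insert hfe]
        simp only [if_true, one_smul]
        have : ∑ x ∈ t.erase g, (if x = f then 1 else y g - y x) • x
            = ∑ x ∈ t.erase g, (y g • x - y x • x) := by
          refine Finset.sum_congr rfl fun x hx => ?_
          rw [if_neg (fun h1 : x = f => hfe (h1 ▸ hx)), sub_smul]
        rw [this, Finset.sum_sub_distrib, ← Finset.smul_sum]
        nth_rewrite 1 [hyf]
        nth_rewrite 1 [hhg]
        rw [smul_add]
        abel
    obtain ⟨s', hs', hP', hmin⟩ := exists_min_PP hP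
    have hsG : ∀ x ∈ s', x ∈ G0 := by
      intro x hx
      have := hs' hx
      rw [hs, Finset.mem_insert] at this
      rcases this with rfl | h1
      · exact hf
      · exact htG x (Finset.mem_of_mem_erase h1)
    have hns : ∀ z, z ≠ f → z ∉ t → z ∉ s' := by
      intro z hz1 hz2 hz
      have := hs' hz
      rw [hs, Finset.mem_insert] at this
      rcases this with h1 | h1
      · exact hz1 h1
      · exact hz2 (Finset.mem_of_mem_erase h1)
    obtain ⟨hcs, -, hsum⟩ := st_main hn hexp hcG hc hp hm hord hsG (hns h hfh.symm hp')
      (hns (-h) hfm.symm hm') hmin hP'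
    have hscard : s.card = n - 1 := by
      rw [hs, Finset.card_insert_of_notMem hfe, Finset.card_erase_of_mem hg, hcard]
      omega
    have hss : s' = s := Finset.eq_of_subset_of_card_le hs' (by omega)
    rw [hss, hs, Finset.sum_insert hfe] at hsum
    have he : ∑ x ∈ t.erase g, x = h - g := by rw [hhg]; abel
    rw [he] at hsum
    rcases hsum with h1 | h1
    · have : f = g := by
        have h2 : f + (h - g) - h = 0 := by rw [← h1]; abel
        have h3 : f - g = 0 := by rw [← h2]; abel
        exact sub_eq_zero.1 h3
      exact absurd (this ▸ hg) hft
    · have : f - (g - 2 • h) = 0 := by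
        have h2 : h + (f + (h - g)) = 0 := by
          nth_rewrite 1 [h1]; abel
        rw [← h2]; abel
      exact sub_eq_zero.1 this
  have hexg : ∃ g ∈ t, ¬ (n : ℤ) ∣ y g := by
    by_contra hno
    push Not at hno
    apply hf0
    rw [hy]
    refine Finset.sum_eq_zero fun g hg => ?_
    obtain ⟨m, hm⟩ := hno g hg
    rw [hm, mul_comm, mul_smul, natCast_zsmul, hexp, smul_zero]
  obtain ⟨g, hg, hng⟩ := hexg
  have hfg := key g hg hng
  obtain ⟨g', hg', hne⟩ : ∃ g' ∈ t, g' ≠ g := Finset.exists_mem_ne (by omega) g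
  have hz : ∑ x ∈ t, (y x - (if x = g then 1 else 0) + 2) • x = 0 := by
    have h2 : ∑ x ∈ t, (2 : ℤ) • x = (2 : ℤ) • h := by rw [← Finset.smul_sum, ← hh]
    simp only [add_smul, sub_smul, Finset.sum_add_distrib, Finset.sum_sub_distrib, ← hy, h2]
    simp only [ite_smul, one_smul, zero_smul, Finset.sum_ite_eq', if_pos hg]
    rw [hfg]
    abel
  have hd := hi _ hz g' hg'
  rw [if_neg hne, sub_zero] at hd
  have := key g' hg' (by
    intro hd'
    have h2 : (n : ℤ) ∣ 2 := by
      have := dvd_sub hd hd'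
      simpa using this
    have := Int.le_of_dvd (by norm_num) h2
    omega)
  rw [hfg] at this
  exact hne (sub_left_injective this).symm
end Conn


end Part7

section Part8

set_option linter.unusedSectionVars false

section Upper
variable {G : Type*} [AddCommGroup G] [Fintype G]

lemma card_le_wt (f : G → ℕ) (hf : ∀ g, 1 ≤ f g) (U : Multiset G) : Multiset.card U ≤ wt f U := by
  induction U using Multiset.induction_on with
  | empty => simp
  | cons a s ih =>
    rw [Multiset.card_cons, ← Multiset.singleton_add, wt_add, wt_singleton]
    have := hf a
    omega

lemma low_atom {n : ℕ} (hn : 4 ≤ n) (hexp : ∀ g : G, n • g = 0) {G0 : Set G} (hc : Cong G0 (n - 2))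
    {U : Multiset G} (hU : IsMinZeroSum G0 U) (hlt : crossNum U < 1) :
    ∃ g ∈ U, -g ∈ U ∧ addOrderOf g = n := by
  have hdv : ∀ g : G, addOrderOf g ∣ n := fun g => addOrderOf_dvd_of_nsmul_eq_zero (hexp g)
  have hnR : (0:ℝ) < n := by exact_mod_cast (by omega : 0 < n)
  obtain ⟨F, hF, hFs, hFc⟩ := fac_ord hexp U hU.2.1
  have hN := wt_ord hexp U
  set N := wt (fun g => n / addOrderOf g) U with hNdef
  have hNlt : N < n := by
    have : (N : ℝ) < n := by rw [hN]; nlinarith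
    exact_mod_cast this
  have hf1 : ∀ g : G, 1 ≤ n / addOrderOf g := fun g =>
    Nat.div_pos (Nat.le_of_dvd (by omega) (hdv g)) (addOrderOf_pos g)
  have hcard := card_le_wt _ hf1 U
  rw [← hNdef] at hcard
  have hcU : Multiset.card U ≠ 0 := by simpa using hU.1
  have hcg := hc F (n • {U}) hF ((isFac_singleton hU).nsmul n) (by rw [hFs, Multiset.sum_nsmul]; simp)
  rw [hFc] at hcg
  simp only [Multiset.card_nsmul, Multiset.card_singleton, smul_eq_mul, mul_one] at hcg
  have hN2 : N = 2 := by
    have h1 : ((n - 2 : ℕ) : ℤ) ∣ (N : ℤ) - 2 := by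
      have : (N : ℤ) - 2 = (N - n) + ((n - 2 : ℕ) : ℤ) := by omega
      rw [this]
      exact dvd_add hcg dvd_rfl
    have := Int.eq_zero_of_abs_lt_dvd h1 (by rw [abs_lt]; constructor <;> omega)
    omega
  have h12 : Multiset.card U = 1 ∨ Multiset.card U = 2 := by omega
  rcases h12 with h1 | h1
  · obtain ⟨g, rfl⟩ := Multiset.card_eq_one.1 h1
    have := hU.2.2.1
    simp at this
    subst this
    simp [crossNum] at hlt
  · obtain ⟨a, b, rfl⟩ := Multiset.card_eq_two.1 h1
    have hs := hU.2.2.1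
    simp at hs
    have hb : b = -a := (neg_eq_of_add_eq_zero_right hs).symm
    refine ⟨a, by simp, by simp [hb], ?_⟩
    have h2 : N = n / addOrderOf a + n / addOrderOf b := by simp [hNdef, wt]
    rw [hb, addOrderOf_neg] at h2
    have h3 : n / addOrderOf a = 1 := by omega
    obtain ⟨m, hm⟩ := hdv a
    have h4 : n / addOrderOf a = m := by
      rw [hm]
      exact Nat.mul_div_cancel_left m (by
        have := addOrderOf_pos a
        exact this)
    rw [hm, ← h4, h3, mul_one]

lemma one_le_KG0 {G0 : Set G} (hd : deltaG0 G0 ≠ ∅) : 1 ≤ KG0 G0 := by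
  obtain ⟨A, hA⟩ := exists_atom_of_delta hd
  obtain ⟨g, hg⟩ := Multiset.exists_mem_of_ne_zero hA.1
  have h1 := le_KG0 (atom_ord (G0 := G0) (hA.2.1 g hg))
  rw [crossNum_eq, wt_nsmul, wt_singleton] at h1
  have h2 : (0:ℝ) < addOrderOf g := by exact_mod_cast addOrderOf_pos g
  simp only [nsmul_eq_mul] at h1
  rw [mul_one_div_cancel h2.ne'] at h1
  exact h1

lemma disc_rho {n : ℕ} (hn : 4 ≤ n) (hexp : ∀ g : G, n • g = 0) {G0 : Set G} (hc : Cong G0 (n - 2))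
    (hd : deltaG0 G0 ≠ ∅)
    (hno : ∀ h, h ∈ G0 → -h ∈ G0 → addOrderOf h = n →
      ¬ PP h (Finset.univ.filter (fun g => g ∈ G0 ∧ g ≠ h ∧ g ≠ -h))) :
    rhoG0 G0 ≤ max ((n : ℝ) / 2) (KG0 G0) := by
  have hnR : (4:ℝ) ≤ n := by exact_mod_cast hn
  have hnR0 : (0:ℝ) < n := by linarith
  set w : G → ℝ := fun g => 1 / (addOrderOf g : ℝ) +
    (if g ∈ G0 ∧ -g ∈ G0 ∧ addOrderOf g = n then ((n : ℝ) - 2) / (2 * n) else 0) with hw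
  refine rhoG0_le w _ (le_max_of_le_left (by linarith)) ?_
  intro U hU
  by_cases hs : ∃ h ∈ U, -h ∈ G0 ∧ addOrderOf h = n
  · obtain ⟨h, hhU, hm, hord⟩ := hs
    have hp := hU.2.1 h hhU
    have hh0 : h ≠ 0 := by
      rintro rfl
      simp at hord
      omega
    have hwh : w h = 1 / n + ((n : ℝ) - 2) / (2 * n) := by
      simp only [hw]; rw [if_pos ⟨hp, hm, hord⟩, hord]
    have hwm : w (-h) = 1 / n + ((n : ℝ) - 2) / (2 * n) := by
      simp only [hw]; rw [if_pos ⟨hm, by simpa using hp, by rwa [addOrderOf_neg]⟩, addOrderOf_neg, hord]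
    have hhm : h ≠ -h := by
      intro h1
      have h2 : 2 • h = 0 := by rw [two_nsmul]; nth_rewrite 2 [h1]; simp
      have := Nat.le_of_dvd (by norm_num) (addOrderOf_dvd_of_nsmul_eq_zero h2)
      omega
    by_cases hmU : -h ∈ U
    · have : U = {h} + {-h} := by
        refine (hU.eq_of_le ?_ (by simp) (by simp)).symm
        rw [Multiset.le_iff_count]
        intro g
        rw [Multiset.count_add, Multiset.count_singleton, Multiset.count_singleton]
        have h1 := Multiset.count_pos.2 hhU
        have h2 := Multiset.count_pos.2 hmU
        split_ifs with e1 e2 e2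
        · exact absurd (e1.symm.trans e2) hhm
        · subst e1; omega
        · subst e2; omega
        · omega
      rw [this, wt_add, wt_singleton, wt_singleton, hwh, hwm]
      have : 1 / (n:ℝ) + ((n : ℝ) - 2) / (2 * n) + (1 / n + ((n : ℝ) - 2) / (2 * n)) = 1 := by
        field_simp; ring
      rw [this]
      exact ⟨le_rfl, le_max_of_le_left (by linarith)⟩
    · have hdvd : n ∣ U.count h := by
        have h1 := hno h hp hm hord
        set t := Finset.univ.filter (fun g => g ∈ G0 ∧ g ≠ h ∧ g ≠ -h) with ht
        have h2 := sum_of_supp U (insert h t) (fun g hg => by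
          rw [Finset.mem_insert, ht, Finset.mem_filter]
          by_cases e : g = h
          · exact Or.inl e
          · right
            refine ⟨Finset.mem_univ _, hU.2.1 g hg, e, ?_⟩
            rintro rfl
            exact hmU hg)
        rw [hU.2.2.1, Finset.sum_insert (by simp [ht])] at h2
        by_contra hnd
        refine h1 ⟨fun g => (U.count g : ℤ), -(U.count h : ℤ), ?_, ?_⟩
        · rw [neg_smul, neg_ne_zero, natCast_zsmul, Ne, ← addOrderOf_dvd_iff_nsmul_eq_zero, hord]
          exact hnd
        · simp only [natCast_zsmul, neg_smul]
          exact (neg_eq_of_add_eq_zero_right h2.symm).symm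
      have hle : n ≤ U.count h := Nat.le_of_dvd (Multiset.count_pos.2 hhU) hdvd
      have : U = n • {h} := by
        refine (hU.eq_of_le (nsmul_le_of_count hle) ?_ ?_).symm
        · simp [Multiset.sum_nsmul, hexp]
        · rw [Multiset.nsmul_singleton]
          intro h0
          have := congrArg Multiset.card h0
          simp at this
          omega
      rw [this, wt_nsmul, wt_singleton, hwh, nsmul_eq_mul]
      have : (n:ℝ) * (1 / (n:ℝ) + ((n : ℝ) - 2) / (2 * n)) = n / 2 := by field_simp; ring
      rw [this]
      exact ⟨by linarith, le_max_left _ _⟩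
  · push Not at hs
    have : wt w U = crossNum U := by
      rw [crossNum_eq]
      unfold wt
      congr 1
      refine Multiset.map_congr rfl fun g hg => ?_
      simp only [hw]
      rw [if_neg (fun h => hs g hg h.2.1 h.2.2), add_zero]
    rw [this]
    refine ⟨?_, le_max_of_le_right (le_KG0 hU)⟩
    by_contra hlt
    obtain ⟨g, hg, hmg, ho⟩ := low_atom hn hexp hc hU (not_le.1 hlt)
    exact hs g hg (hU.2.1 _ hmg) ho

lemma conn_rho {n : ℕ} (hn : 4 ≤ n) (hexp : ∀ g : G, n • g = 0)
    (hcG : Fintype.card G ≤ n ^ (n - 1)) {G0 : Set G} (hc : Cong G0 (n - 2))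
    {h : G} (hp : h ∈ G0) (hm : -h ∈ G0) (hord : addOrderOf h = n) {t : Finset G}
    (htG : ∀ g ∈ t, g ∈ G0) (hp' : h ∉ t) (hm' : -h ∉ t)
    (hcard : t.card = n - 1) (hi : IndepN n t) (hh : h = ∑ g ∈ t, g) :
    rhoG0 G0 ≤ 1 + (n : ℝ) * (n - 2) / (n + 1) := by
  have hsub := conn_sub hn hexp hcG hc hp hm hord htG hp' hm' hcard hi hh
  have hnR : (4:ℝ) ≤ n := by exact_mod_cast hn
  have hnR0 : (0:ℝ) < n := by linarith
  have hh0 : h ≠ 0 := by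
    rintro rfl
    simp at hord
    omega
  have hhm : h ≠ -h := by
    intro h1
    have h2 : 2 • h = 0 := by rw [two_nsmul]; nth_rewrite 2 [h1]; simp
    have := Nat.le_of_dvd (by norm_num) (addOrderOf_dvd_of_nsmul_eq_zero h2)
    omega
  have hcR : (t.card : ℝ) = n - 1 := by
    rw [hcard, Nat.cast_sub (by omega)]; simp
  set w : G → ℝ := fun g => 1 / (addOrderOf g : ℝ) + (if g = h then ((n : ℝ) - 2) / (n * (n + 1)) else
    if g = -h then ((n : ℝ) - 2) / (n + 1) else 0) with hw
  have hwh : w h = 1 / n + ((n : ℝ) - 2) / (n * (n + 1)) := by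
    simp only [hw]; rw [if_pos trivial, hord]
  have hwm : w (-h) = 1 / n + ((n : ℝ) - 2) / (n + 1) := by
    simp only [hw]; rw [if_neg hhm.symm, if_pos trivial, addOrderOf_neg, hord]
  have hwt : ∀ g ∈ t, w g = 1 / n := by
    intro g hg
    simp only [hw]
    rw [if_neg (fun e : g = h => hp' (e ▸ hg)), if_neg (fun e : g = -h => hm' (e ▸ hg)),
      indep_exp_addOrderOf hexp hi hg, add_zero]
  have hw0 : w 0 = 1 := by
    simp only [hw]
    rw [if_neg hh0.symm, if_neg (fun e : 0 = -h => hh0 (by simpa using e.symm))]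
    simp
  have hwseq : ∀ m : ℕ, wt w (seqOf t (fun _ => m)) = ((n:ℝ) - 1) * (m * (1 / n)) := by
    intro m
    rw [wt_seqOf, Finset.sum_congr rfl (fun g hg => by rw [hwt g hg]), Finset.sum_const, nsmul_eq_mul,
      nsmul_eq_mul, hcR]
  have hpos1 : (0:ℝ) < (n:ℝ) + 1 := by linarith
  have hR1 : (0:ℝ) ≤ (n : ℝ) * (n - 2) / (n + 1) := by
    apply div_nonneg <;> nlinarith
  refine rhoG0_le w _ (by linarith) ?_
  intro U hU
  rcases atom_class hn hexp hi hh hp' hm' hU (fun g hg => hsub g (hU.2.1 g hg)) with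
    h1 | h1 | ⟨g, hg, h1⟩ | h1 | h1 | h1 | ⟨x, hx1, hxn, h1⟩
  · rw [h1, wt_singleton, hw0]; constructor <;> linarith
  · have : wt w U = 1 := by
      rw [h1, wt_add, wt_singleton, wt_singleton, hwh, hwm]; field_simp; ring
    rw [this]; constructor <;> linarith
  · have : wt w U = 1 := by
      rw [h1, wt_nsmul, wt_singleton, hwt g hg, nsmul_eq_mul]; field_simp
    rw [this]; constructor <;> linarith
  · have : wt w U = 1 + (n - 2) / (n + 1) := by
      rw [h1, wt_nsmul, wt_singleton, hwh, nsmul_eq_mul]; field_simp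
    rw [this]
    constructor
    · have : 0 ≤ ((n:ℝ) - 2) / (n + 1) := div_nonneg (by linarith) (by linarith)
      linarith
    · gcongr
      nlinarith
  · have : wt w U = 1 + (n : ℝ) * (n - 2) / (n + 1) := by
      rw [h1, wt_nsmul, wt_singleton, hwm, nsmul_eq_mul]; field_simp
    rw [this]; constructor <;> linarith
  · have : wt w U = 1 + (n - 2) / (n + 1) := by
      rw [h1, wt_add, wt_singleton, hwseq, hwm]; push_cast; field_simp; ring
    rw [this]
    constructor
    · have : 0 ≤ ((n:ℝ) - 2) / (n + 1) := div_nonneg (by linarith) (by linarith)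
      linarith
    · gcongr
      nlinarith
  · have hxR : (x:ℝ) ≤ n - 1 := by
      have : x + 1 ≤ n := hxn
      have : (x:ℝ) + 1 ≤ n := by exact_mod_cast this
      linarith
    have hx1R : (1:ℝ) ≤ x := by exact_mod_cast hx1
    have : wt w U = 1 + (n : ℝ) * (n - 2) / (n + 1) - (x - 1) * (n - 2) / (n + 1) := by
      rw [h1, wt_add, wt_nsmul, wt_singleton, hwseq, hwh, nsmul_eq_mul, Nat.cast_sub hxn.le]
      field_simp; ring
    rw [this]
    constructor
    · have : (x - 1) * ((n:ℝ) - 2) / (n + 1) ≤ (n : ℝ) * (n - 2) / (n + 1) := by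
        gcongr
        · linarith
        · linarith
      linarith
    · have : 0 ≤ ((x:ℝ) - 1) * ((n:ℝ) - 2) / (n + 1) :=
        div_nonneg (mul_nonneg (by linarith) (by linarith)) (by linarith)
      linarith

theorem rho_upper {n : ℕ} (hn : 4 ≤ n) (hexp : ∀ g : G, n • g = 0)
    (hcG : Fintype.card G ≤ n ^ (n - 1)) {G0 : Set G} (hc : Cong G0 (n - 2))
    (hd : deltaG0 G0 ≠ ∅) : rhoG0 G0 ≤ max ((n : ℝ) / 2) (KG0 G0) ∨
      (n ^ (n - 1) ≤ Fintype.card G ∧ rhoG0 G0 ≤ 1 + (n : ℝ) * (n - 2) / (n + 1)) := by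
  by_cases hno : ∀ h, h ∈ G0 → -h ∈ G0 → addOrderOf h = n →
      ¬ PP h (Finset.univ.filter (fun g => g ∈ G0 ∧ g ≠ h ∧ g ≠ -h))
  · left
    exact disc_rho hn hexp hc hd hno
  · right
    push Not at hno
    obtain ⟨h, hp, hm, hord, hP⟩ := hno
    obtain ⟨t, hts, hPt, hmin⟩ := exists_min_PP hP
    have htG : ∀ g ∈ t, g ∈ G0 := fun g hg => (Finset.mem_filter.1 (hts hg)).2.1
    have hp' : h ∉ t := fun hg => (Finset.mem_filter.1 (hts hg)).2.2.1 rfl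
    have hm' : -h ∉ t := fun hg => (Finset.mem_filter.1 (hts hg)).2.2.2 rfl
    obtain ⟨hcard, hi, hsum⟩ := st_main hn hexp hcG hc hp hm hord htG hp' hm' hmin hPt
    refine ⟨hcard ▸ card_pow_le hi, ?_⟩
    rcases hsum with h1 | h1
    · exact conn_rho hn hexp hcG hc hp hm hord htG hp' hm' hcard hi h1
    · exact conn_rho hn hexp hcG hc hm (by simpa using hp) (by rwa [addOrderOf_neg]) htG hm'
        (by simpa using hp') hcard hi (by rw [h1, neg_neg])
end Upper


end Part8

section Part9

set_option linter.unusedSectionVars false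

section Ex1
variable {G : Type*} [AddCommGroup G] [Fintype G]

lemma ex1 {n : ℕ} (hn : 4 ≤ n) (hexp : ∀ g : G, n • g = 0) {t : Finset G} (hi : IndepN n t)
    (hcard : t.card = n - 1) : 1 + (n : ℝ) * (n - 2) / (n + 1) ≤ rhoStar G (n - 2) := by
  have hnR : (4:ℝ) ≤ n := by exact_mod_cast hn
  have hnR0 : (0:ℝ) < n := by linarith
  set h := ∑ g ∈ t, g with hh
  have hot : ∀ g ∈ t, addOrderOf g = n := fun g hg => indep_exp_addOrderOf hexp hi hg
  have hn1 : ¬ (n : ℤ) ∣ 1 := by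
    intro h1
    have := Int.le_of_dvd (by norm_num) h1
    omega
  have hcR : (t.card : ℝ) = n - 1 := by
    rw [hcard, Nat.cast_sub (by omega)]; simp
  have hp' : h ∉ t := by
    intro hg
    obtain ⟨g', hg', hne⟩ : ∃ g' ∈ t, g' ≠ h := Finset.exists_mem_ne (by omega) h
    have := hi (fun x => 1 - if x = h then 1 else 0) (by
      simp only [sub_smul, Finset.sum_sub_distrib, one_smul, ite_smul, zero_smul,
        Finset.sum_ite_eq', if_pos hg]
      rw [← hh, sub_self]) g' hg'
    rw [if_neg hne, sub_zero] at this
    exact hn1 this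
  have hm' : -h ∉ t := by
    intro hg
    obtain ⟨g', hg', hne⟩ : ∃ g' ∈ t, g' ≠ -h := Finset.exists_mem_ne (by omega) (-h)
    have := hi (fun x => 1 + if x = -h then 1 else 0) (by
      simp only [add_smul, Finset.sum_add_distrib, one_smul, ite_smul, zero_smul,
        Finset.sum_ite_eq', if_pos hg]
      rw [← hh]; simp) g' hg'
    rw [if_neg hne, add_zero] at this
    exact hn1 this
  have hord : addOrderOf h = n := by
    refine Nat.dvd_antisymm (addOrderOf_dvd_of_nsmul_eq_zero (hexp h)) ?_
    obtain ⟨g, hg⟩ : t.Nonempty := Finset.card_ne_zero.1 (by omega)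
    have := hi (fun _ => (addOrderOf h : ℤ)) (by
      rw [← Finset.smul_sum, ← hh, natCast_zsmul, addOrderOf_nsmul_eq_zero]) g hg
    exact Int.natCast_dvd_natCast.1 this
  have hh0 : h ≠ 0 := by
    intro h0
    rw [h0] at hord
    simp at hord
    omega
  have hhm : h ≠ -h := by
    intro h1
    have h2 : 2 • h = 0 := by rw [two_nsmul]; nth_rewrite 2 [h1]; simp
    have := Nat.le_of_dvd (by norm_num) (addOrderOf_dvd_of_nsmul_eq_zero h2)
    omega
  set G0 : Set G := {g | g = h ∨ g = -h ∨ g ∈ t} with hG0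
  have hp : h ∈ G0 := Or.inl rfl
  have hm : -h ∈ G0 := Or.inr (Or.inl rfl)
  have htG : ∀ g ∈ t, g ∈ G0 := fun g hg => Or.inr (Or.inr hg)
  have hz : (0 : G) ∉ G0 := by
    rintro (h1 | h1 | h1)
    · exact hh0 h1.symm
    · exact hh0 (by simpa using h1.symm)
    · have := hot 0 h1
      simp at this
      omega
  set α : ℝ := 1 - (n - 1) + (n - 1) / n with hα
  set w : G → ℝ := fun g => if g = h then α else if g = -h then 1 - α else 1 / n with hw
  have hwh : w h = α := by simp [hw]
  have hwm : w (-h) = 1 - α := by simp [hw, hhm.symm]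
  have hwt : ∀ g ∈ t, w g = 1 / n := by
    intro g hg
    simp only [hw]
    rw [if_neg (fun e : g = h => hp' (e ▸ hg)), if_neg (fun e : g = -h => hm' (e ▸ hg))]
  have hwseq : ∀ m : ℕ, wt w (seqOf t (fun _ => m)) = ((n:ℝ) - 1) * (m * (1 / n)) := by
    intro m
    rw [wt_seqOf, Finset.sum_congr rfl (fun g hg => by rw [hwt g hg]), Finset.sum_const, nsmul_eq_mul,
      nsmul_eq_mul, hcR]
  have hdR : ((n - 2 : ℕ) : ℝ) = n - 2 := by rw [Nat.cast_sub (by omega)]; simp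
  have hcong : Cong G0 (n - 2) := by
    refine cong_of_weight w fun U hU => ?_
    rw [hdR]
    rcases atom_class hn hexp hi hh hp' hm' hU (fun g hg => Or.inr (hU.2.1 g hg)) with
      h1 | h1 | ⟨g, hg, h1⟩ | h1 | h1 | h1 | ⟨x, hx1, hxn, h1⟩
    · exfalso
      exact hz (hU.2.1 0 (by rw [h1]; simp))
    · refine ⟨0, ?_⟩
      rw [h1, wt_add, wt_singleton, wt_singleton, hwh, hwm]; simp
    · refine ⟨0, ?_⟩
      rw [h1, wt_nsmul, wt_singleton, hwt g hg, nsmul_eq_mul]; field_simp; simp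
    · refine ⟨-(n - 1), ?_⟩
      rw [h1, wt_nsmul, wt_singleton, hwh, nsmul_eq_mul, hα]; push_cast; field_simp; ring
    · refine ⟨n, ?_⟩
      rw [h1, wt_nsmul, wt_singleton, hwm, nsmul_eq_mul, hα]; push_cast; field_simp; ring
    · refine ⟨1, ?_⟩
      rw [h1, wt_add, wt_singleton, hwseq, hwm, hα]; push_cast; field_simp; ring
    · refine ⟨1 - x, ?_⟩
      rw [h1, wt_add, wt_nsmul, wt_singleton, hwseq, hwh, nsmul_eq_mul, Nat.cast_sub hxn.le, hα]
      push_cast; field_simp; ring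
  have hv : ∑ g ∈ t, (-1 : ℤ) • g = -h := by rw [← Finset.smul_sum, ← hh, neg_one_smul]
  set W := {h} + seqOf t (fun _ => n - 1) with hW
  have hWs : ∀ g ∈ W, g = h ∨ g ∈ t := by
    intro g hg
    rw [hW, Multiset.mem_add, Multiset.mem_singleton] at hg
    exact hg.imp id mem_seqOf
  have hWat : IsMinZeroSum G0 W := by
    refine atom_one hi hp' hv hWs ?_ ?_ ?_ ?_
    · intro g hg
      rcases hWs g hg with h1 | hg
      · exact h1 ▸ hp
      · exact htG g hg
    · rw [hW, Multiset.sum_add, sum_seqOf, ← Finset.smul_sum, ← hh, Multiset.sum_singleton]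
      have : h + (n - 1) • h = (n - 1 + 1) • h := by rw [succ_nsmul]; abel
      rw [this, Nat.sub_add_cancel (by omega), hexp]
    · rw [hW, Multiset.count_add, count_seqOf, if_neg hp']; simp
    · intro g hg
      rw [hW, Multiset.count_add, count_seqOf, if_pos hg, Multiset.count_singleton,
        if_neg (fun hh : g = h => hp' (hh ▸ hg))]
      omega
  have hnat : ∀ g ∈ t, IsMinZeroSum G0 (n • {g}) := fun g hg => by
    have := atom_ord (G0 := G0) (htG g hg)
    rwa [hot g hg] at this
  have hnm : IsMinZeroSum G0 (n • {-h}) := by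
    have := atom_ord (G0 := G0) hm
    rwa [addOrderOf_neg, hord] at this
  set F : Multiset (Multiset G) := n • {({h} + {-h} : Multiset G)} +
    (n - 1) • ∑ g ∈ t, ({n • ({g} : Multiset G)} : Multiset (Multiset G)) with hF
  set F' : Multiset (Multiset G) := n • {W} + {n • ({-h} : Multiset G)} with hF'
  have hFf : IsFac G0 F := by
    refine IsFac.add ((isFac_singleton (atom_pair hp hm hh0)).nsmul n) (IsFac.nsmul ?_ _)
    exact (isFac_sum t _ fun g hg => isFac_singleton (hnat g hg))
  have hFf' : IsFac G0 F' := ((isFac_singleton hWat).nsmul n).add (isFac_singleton hnm)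
  have hsum : F.sum = F'.sum := by
    have e1 : (∑ g ∈ t, ({n • ({g} : Multiset G)} : Multiset (Multiset G))).sum
        = ∑ g ∈ t, n • ({g} : Multiset G) := by
      rw [← Multiset.coe_sumAddMonoidHom, map_sum]; simp
    rw [hF, hF', Multiset.sum_add, Multiset.sum_add, Multiset.sum_nsmul, Multiset.sum_nsmul,
      Multiset.sum_nsmul, Multiset.sum_singleton, Multiset.sum_singleton, Multiset.sum_singleton,
      e1, hW]
    unfold seqOf
    rw [← Finset.smul_sum, ← Finset.smul_sum, smul_add, smul_add, smul_comm n (n-1)]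
    abel
  have hcF : Multiset.card F = n + (n - 1) * (n - 1) := by
    rw [hF]
    simp [hcard]
  have hcF' : Multiset.card F' = n + 1 := by
    rw [hF']; simp
  have hne : deltaG0 G0 ≠ ∅ := by
    refine delta_ne hFf hFf' hsum ?_
    rw [hcF, hcF']
    obtain ⟨m, rfl⟩ : ∃ m, n = m + 4 := ⟨n - 4, by omega⟩
    simp only [show m + 4 - 1 = m + 3 from rfl]
    nlinarith
  refine le_trans ?_ (le_rhoStar hne hcong)
  refine le_trans (le_of_eq ?_) (le_rhoG0 F F' hFf hFf' hsum ?_)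
  · rw [hcF, hcF']
    push_cast [Nat.cast_sub (show 1 ≤ n by omega)]
    field_simp
    ring
  · intro h0
    rw [h0] at hcF'
    simp at hcF'
end Ex1

section Ex2
variable {G : Type*} [AddCommGroup G] [Fintype G]

/-- least nonnegative residue of `-x` modulo `o` -/
def negMod (o x : ℕ) : ℕ := ((-(x : ℤ)) % (o : ℤ)).toNat

lemma negMod_cast {o : ℕ} (ho : 0 < o) (x : ℕ) : (negMod o x : ℤ) = (-(x : ℤ)) % o :=
  Int.toNat_of_nonneg (Int.emod_nonneg _ (by omega))

lemma dvd_add_negMod {o : ℕ} (ho : 0 < o) (x : ℕ) : o ∣ x + negMod o x := by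
  have : (o : ℤ) ∣ ((x + negMod o x : ℕ) : ℤ) := by
    push_cast
    rw [negMod_cast ho]
    refine ⟨-((-(x : ℤ)) / o), ?_⟩
    linear_combination Int.emod_add_mul_ediv (-(x : ℤ)) o
  exact Int.natCast_dvd_natCast.1 this

lemma negMod_le {o : ℕ} (ho : 0 < o) {x c : ℕ} (h : o ∣ x + c) : negMod o x ≤ c := by
  have h1 : (-(x : ℤ)) % o = (c : ℤ) % o := by
    have h2 : Int.ModEq o (-(x : ℤ)) c := by
      rw [Int.modEq_iff_dvd]
      obtain ⟨m, hm⟩ := h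
      refine ⟨m, ?_⟩
      zify at hm
      linear_combination hm
    exact h2
  zify
  rw [negMod_cast ho, h1]
  exact_mod_cast Nat.mod_le c o

lemma negMod_lt {o : ℕ} (ho : 0 < o) (x : ℕ) : negMod o x < o := by
  zify
  rw [negMod_cast ho]
  exact Int.emod_lt_of_pos _ (by omega)

lemma ex2 {n d : ℕ} (hn : 0 < n) (hexp : ∀ g : G, n • g = 0) {t : Finset G}
    (hi : ∀ y : G → ℤ, ∑ g ∈ t, y g • g = 0 → ∀ g ∈ t, y g • g = 0) {g0 : G} (hg0 : g0 ∈ t)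
    (hdv : ∀ g ∈ t, addOrderOf g ∣ addOrderOf g0) (h2 : ∀ g ∈ t, 2 ≤ addOrderOf g)
    (hne : (t.erase g0).Nonempty)
    (hd : ∀ f : ℕ → ℤ, (d : ℤ) ∣ ∑ g ∈ t.erase g0, f (addOrderOf g)) :
    1 + ∑ g ∈ t.erase g0, (1 - 1 / (addOrderOf g : ℝ)) ≤ KGd G d := by
  set h := ∑ g ∈ t, g with hh
  set q := addOrderOf g0 with hq
  have hq2 : 2 ≤ q := h2 g0 hg0
  have hopos : ∀ g : G, 0 < addOrderOf g := addOrderOf_pos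
  have hp' : h ∉ t := by
    intro hg
    obtain ⟨g1, hg1⟩ := hne
    have hc : 1 < t.card := by
      rw [Finset.one_lt_card]
      exact ⟨g0, hg0, g1, Finset.mem_of_mem_erase hg1, (Finset.ne_of_mem_erase hg1).symm⟩
    obtain ⟨g', hg', hne'⟩ : ∃ g' ∈ t, g' ≠ h := Finset.exists_mem_ne hc h
    have := hi (fun x => 1 - if x = h then 1 else 0) (by
      simp only [sub_smul, Finset.sum_sub_distrib, one_smul, ite_smul, zero_smul,
        Finset.sum_ite_eq', if_pos hg]
      rw [← hh, sub_self]) g' hg'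
    simp only [if_neg hne', sub_zero, one_smul] at this
    have h3 := h2 g' hg'
    rw [this] at h3
    simp at h3
  have hqh : q • h = 0 := by
    rw [hh, Finset.smul_sum]
    exact Finset.sum_eq_zero fun g hg => addOrderOf_dvd_iff_nsmul_eq_zero.1 (hdv g hg)
  have hord : addOrderOf h = q := by
    refine Nat.dvd_antisymm (addOrderOf_dvd_of_nsmul_eq_zero hqh) ?_
    have := hi (fun _ => (addOrderOf h : ℤ)) (by
      rw [← Finset.smul_sum, ← hh, natCast_zsmul, addOrderOf_nsmul_eq_zero]) g0 hg0
    rw [natCast_zsmul] at this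
    exact addOrderOf_dvd_of_nsmul_eq_zero this
  set G0 : Set G := {g | g = h ∨ g ∈ t} with hG0
  have zs : ∀ S : Multiset G, (∀ g ∈ S, g = h ∨ g ∈ t) → S.sum = 0 → ∀ g ∈ t,
      addOrderOf g ∣ S.count h + S.count g := by
    intro S hS hS0 g hg
    have h1 := sum_of_supp S (insert h t) (fun g hg => by simpa using hS g hg)
    rw [hS0, Finset.sum_insert hp'] at h1
    have := hi (fun g => ((S.count h + S.count g : ℕ) : ℤ)) (by
      simp only [natCast_zsmul, add_smul, Finset.sum_add_distrib]
      rw [← Finset.smul_sum, ← hh]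
      exact h1.symm) g hg
    rw [natCast_zsmul] at this
    exact addOrderOf_dvd_of_nsmul_eq_zero this
  have cls : ∀ V, IsMinZeroSum G0 V → (∃ g ∈ t, V = addOrderOf g • {g}) ∨
      ∃ x : ℕ, 1 ≤ x ∧ x ≤ q ∧ V = x • {h} + seqOf t (fun g => negMod (addOrderOf g) x) := by
    intro V hV
    have hz := zs V hV.2.1 hV.2.2.1
    by_cases hx : V.count h = 0
    · left
      obtain ⟨g, hg⟩ := Multiset.exists_mem_of_ne_zero hV.1
      have hgt : g ∈ t := by
        rcases hV.2.1 g hg with h1 | h1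
        · rw [h1] at hg
          exact absurd hg (Multiset.count_eq_zero.1 hx)
        · exact h1
      refine ⟨g, hgt, ?_⟩
      have h1 := hz g hgt
      rw [hx, zero_add] at h1
      refine (hV.eq_of_le (nsmul_le_of_count (Nat.le_of_dvd (Multiset.count_pos.2 hg) h1)) ?_ ?_).symm
      · simp [Multiset.sum_nsmul, addOrderOf_nsmul_eq_zero]
      · exact (atom_ord (G0 := G0) (Or.inr hgt)).1
    · right
      refine ⟨min (V.count h) q, by omega, min_le_right _ _, ?_⟩
      set x := min (V.count h) q with hxdef
      refine (hV.eq_of_le (split_le hp' (min_le_left _ _) fun g hg => ?_) ?_ ?_).symm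
      · rcases le_total (V.count h) q with hle | hle
        · rw [hxdef, min_eq_left hle]
          exact negMod_le (hopos g) (hz g hg)
        · rw [hxdef, min_eq_right hle]
          refine (negMod_le (hopos g) (c := 0) (by simpa using hdv g hg)).trans (Nat.zero_le _)
      · rw [Multiset.sum_add, sum_seqOf, Multiset.sum_nsmul, Multiset.sum_singleton, hh,
          Finset.smul_sum, ← Finset.sum_add_distrib]
        refine Finset.sum_eq_zero fun g hg => ?_
        rw [← add_smul]
        exact addOrderOf_dvd_iff_nsmul_eq_zero.1 (dvd_add_negMod (hopos g) x)
      · intro h0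
        have := congrArg (Multiset.count h) h0
        rw [Multiset.count_add, Multiset.count_nsmul, Multiset.count_singleton_self,
            Multiset.count_zero] at this
        omega
  set w : G → ℝ := fun g => if g = h then 1 - ∑ g ∈ t, (1 - 1 / (addOrderOf g : ℝ)) else
    1 / (addOrderOf g : ℝ) with hw
  have hwh : w h = 1 - ∑ g ∈ t, (1 - 1 / (addOrderOf g : ℝ)) := by simp only [hw, if_true]
  have hwt : ∀ g ∈ t, w g = 1 / (addOrderOf g : ℝ) := fun g hg => by
    simp only [hw]; rw [if_neg (fun e : g = h => hp' (e ▸ hg))]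
  have hcong : Cong G0 d := by
    refine cong_of_weight w fun V hV => ?_
    rcases cls V hV with ⟨g, hg, rfl⟩ | ⟨x, hx1, hxq, rfl⟩
    · refine ⟨0, ?_⟩
      have : (addOrderOf g : ℝ) ≠ 0 := by exact_mod_cast (hopos g).ne'
      rw [wt_nsmul, wt_singleton, hwt g hg, nsmul_eq_mul, mul_one_div_cancel this]; simp
    · set f : ℕ → ℤ := fun o => (x : ℤ) - ((x + negMod o x) / o : ℕ) with hf
      obtain ⟨m, hm⟩ := hd f
      refine ⟨-m, ?_⟩
      have hfR : ∀ g ∈ t, (f (addOrderOf g) : ℝ) =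
          x * (1 - 1 / (addOrderOf g : ℝ)) - negMod (addOrderOf g) x * (1 / (addOrderOf g : ℝ)) := by
        intro g hg
        have h0 : (addOrderOf g : ℝ) ≠ 0 := by exact_mod_cast (hopos g).ne'
        simp only [hf]
        have e : (((x + negMod (addOrderOf g) x) / addOrderOf g : ℕ) : ℝ) =
            (x + negMod (addOrderOf g) x) / addOrderOf g := by
          rw [Nat.cast_div (dvd_add_negMod (hopos g) x) h0]; push_cast; rfl
        rw [Int.cast_sub, Int.cast_natCast, Int.cast_natCast, e]
        field_simp
        ring
      have hf0 : f q = x - 1 := by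
        simp only [hf]
        have : x + negMod q x = q := by
          have h1 := dvd_add_negMod (show 0 < q by omega) x
          have h3 := negMod_lt (show 0 < q by omega) x
          rcases hxq.lt_or_eq with h4 | h4
          · obtain ⟨k, hk⟩ := h1
            have : k = 1 := by
              have : k < 2 := by by_contra hk2; nlinarith
              have : k ≠ 0 := by rintro rfl; omega
              omega
            rw [hk, this, mul_one]
          · have := negMod_le (o := q) (by omega) (x := x) (c := 0) (by rw [h4]; simp)
            omega
        rw [this, Nat.div_self (by omega)]
        simp
      have hsumf : ∑ g ∈ t, (f (addOrderOf g) : ℝ) = x - 1 + d * m := by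
        rw [← Finset.add_sum_erase t _ hg0]
        have : (f (addOrderOf g0) : ℝ) = x - 1 := by rw [← hq, hf0]; simp
        rw [this]
        congr 1
        exact_mod_cast hm
      rw [wt_add, wt_nsmul, wt_singleton, wt_seqOf, hwh]
      rw [Finset.sum_congr rfl hfR, Finset.sum_sub_distrib, ← Finset.mul_sum] at hsumf
      have e2 : ∑ g ∈ t, negMod (addOrderOf g) x • w g =
          ∑ g ∈ t, (negMod (addOrderOf g) x : ℝ) * (1 / (addOrderOf g : ℝ)) :=
        Finset.sum_congr rfl (fun g hg => by rw [hwt g hg, nsmul_eq_mul])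
      rw [e2, nsmul_eq_mul]
      push_cast
      linear_combination -hsumf
  -- the atom
  set W := {h} + seqOf t (fun g => addOrderOf g - 1) with hW
  have hWs : ∀ g ∈ W, g = h ∨ g ∈ t := by
    intro g hg
    rw [hW, Multiset.mem_add, Multiset.mem_singleton] at hg
    exact hg.imp id mem_seqOf
  have hWh : W.count h = 1 := by
    rw [hW, Multiset.count_add, count_seqOf, if_neg hp']; simp
  have hWg : ∀ g ∈ t, W.count g = addOrderOf g - 1 := by
    intro g hg
    rw [hW, Multiset.count_add, count_seqOf, if_pos hg, Multiset.count_singleton,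
      if_neg (fun e : g = h => hp' (e ▸ hg)), zero_add]
  have hW0 : W.sum = 0 := by
    rw [hW, Multiset.sum_add, sum_seqOf, Multiset.sum_singleton]
    nth_rewrite 1 [hh]
    rw [← Finset.sum_add_distrib]
    refine Finset.sum_eq_zero fun g hg => ?_
    have : g + (addOrderOf g - 1) • g = (addOrderOf g - 1 + 1) • g := by rw [succ_nsmul]; abel
    rw [this, Nat.sub_add_cancel (hopos g), addOrderOf_nsmul_eq_zero]
  have hzero : ∀ T ≤ W, T.sum = 0 → T.count h = 0 → T = 0 := by
    intro T hT hT0 hTc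
    have hTs : ∀ g ∈ T, g = h ∨ g ∈ t := fun g hg => hWs g (Multiset.mem_of_le hT hg)
    refine eq_zero_of_count fun g hg => ?_
    rcases hTs g hg with h1 | h1
    · rw [h1]; exact hTc
    · have h3 := zs T hTs hT0 g h1
      rw [hTc, zero_add] at h3
      refine Nat.eq_zero_of_dvd_of_lt h3 ?_
      have := Multiset.count_le_of_le g hT
      rw [hWg g h1] at this
      have := hopos g
      omega
  have hWat : IsMinZeroSum G0 W := by
    refine ⟨fun h0 => by rw [h0] at hWh; simp at hWh, hWs, hW0, fun T hT hT0 => ?_⟩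
    have hcT := Multiset.count_le_of_le h hT
    rw [hWh] at hcT
    rcases Nat.eq_zero_or_pos (T.count h) with hz | hz
    · exact Or.inl (hzero T hT hT0 hz)
    · right
      have := hzero (W - T) (Multiset.sub_le_self _ _) (sub_zs hT hW0 hT0)
        (by rw [Multiset.count_sub]; omega)
      exact le_antisymm hT (tsub_eq_zero_iff_le.1 this)
  have hcr : crossNum W = 1 + ∑ g ∈ t.erase g0, (1 - 1 / (addOrderOf g : ℝ)) := by
    rw [crossNum_eq, hW, wt_add, wt_singleton, wt_seqOf, hord]
    have : ∑ g ∈ t, (addOrderOf g - 1) • (1 / (addOrderOf g : ℝ)) =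
        ∑ g ∈ t, (1 - 1 / (addOrderOf g : ℝ)) := by
      refine Finset.sum_congr rfl fun g hg => ?_
      have h0 : (addOrderOf g : ℝ) ≠ 0 := by exact_mod_cast (hopos g).ne'
      rw [nsmul_eq_mul, Nat.cast_sub (hopos g)]
      field_simp
      simp
    rw [this, ← Finset.add_sum_erase t _ hg0, ← hq]
    ring
  have hpos : 0 < ∑ g ∈ t.erase g0, (1 - 1 / (addOrderOf g : ℝ)) := by
    refine Finset.sum_pos (fun g hg => ?_) hne
    have : (2:ℝ) ≤ addOrderOf g := by exact_mod_cast h2 g (Finset.mem_of_mem_erase hg)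
    have : 1 / (addOrderOf g : ℝ) ≤ 1 / 2 := one_div_le_one_div_of_le (by norm_num) this
    linarith
  have hdl : deltaG0 G0 ≠ ∅ := delta_ne_of_crossNum hn hexp hWat (by rw [hcr]; linarith)
  rw [← hcr]
  exact (le_KG0 hWat).trans (le_KGd hdl hcong)
end Ex2


end Part9

section Part10

set_option linter.unusedSectionVars false

variable {G : Type*} [AddCommGroup G] [Fintype G]

lemma ex2_idx {n d : ℕ} (hn : 0 < n) (hexp : ∀ g : G, n • g = 0) {κ : Type} [Fintype κ] [Nonempty κ]
    (e0 : G) (e : κ → G)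
    (hi : ∀ (y0 : ℤ) (y : κ → ℤ), y0 • e0 + ∑ k, y k • e k = 0 →
      y0 • e0 = 0 ∧ ∀ k, y k • e k = 0)
    (hdv : ∀ k, addOrderOf (e k) ∣ addOrderOf e0) (h20 : 2 ≤ addOrderOf e0)
    (h2 : ∀ k, 2 ≤ addOrderOf (e k))
    (hd : ∀ f : ℕ → ℤ, (d : ℤ) ∣ ∑ k, f (addOrderOf (e k))) :
    1 + ∑ k, (1 - 1 / (addOrderOf (e k) : ℝ)) ≤ KGd G d := by
  have hne : ∀ k, e k ≠ 0 := fun k hk => by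
    have := h2 k
    rw [hk] at this
    simp at this
  have hinj : Function.Injective e := by
    intro i j hij
    by_contra hne'
    have := (hi 0 (fun k => (if k = i then 1 else 0) - (if k = j then 1 else 0)) (by
      simp [sub_smul, Finset.sum_sub_distrib, hij])).2 i
    simp [hne', hne i] at this
  have h0 : e0 ∉ Finset.univ.image e := by
    intro h
    obtain ⟨k, -, hk⟩ := Finset.mem_image.1 h
    have := (hi 1 (fun j => if j = k then -1 else 0) (by simp [hk])).2 k
    simp [hne k] at this
  have hsum : ∀ {M : Type} [AddCommMonoid M] (f : G → M),
      ∑ g ∈ Finset.univ.image e, f g = ∑ k, f (e k) := fun f =>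
    Finset.sum_image (fun a _ b _ h => hinj h)
  have hers : (insert e0 (Finset.univ.image e)).erase e0 = Finset.univ.image e :=
    Finset.erase_insert h0
  have := ex2 (d := d) hn hexp (t := insert e0 (Finset.univ.image e)) (g0 := e0) (by
      intro y hy
      rw [Finset.sum_insert h0, Finset.sum_image (fun a _ b _ h => hinj h)] at hy
      have := hi _ _ hy
      intro g hg
      rcases Finset.mem_insert.1 hg with rfl | hg
      · exact this.1
      · obtain ⟨k, -, rfl⟩ := Finset.mem_image.1 hg
        exact this.2 k) (Finset.mem_insert_self _ _) (by
      intro g hg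
      rcases Finset.mem_insert.1 hg with rfl | hg
      · exact dvd_rfl
      · obtain ⟨k, -, rfl⟩ := Finset.mem_image.1 hg
        exact hdv k) (by
      intro g hg
      rcases Finset.mem_insert.1 hg with rfl | hg
      · exact h20
      · obtain ⟨k, -, rfl⟩ := Finset.mem_image.1 hg
        exact h2 k) (by
      rw [hers]; exact Finset.univ_nonempty.image e) (by
      intro f
      rw [hers, hsum]
      exact hd f)
  rwa [hers, hsum] at this

lemma ord_single {r : ℕ} {n : Fin r → ℕ} (φ : G ≃+ (∀ i : Fin r, ZMod (n i))) (i : Fin r)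
    (c : ZMod (n i)) : addOrderOf (φ.symm (Pi.single i c)) = addOrderOf c := by
  rw [AddEquiv.addOrderOf_eq]
  exact addOrderOf_injective (AddMonoidHom.single (fun i => ZMod (n i)) i)
    (fun a b h => by simpa using congrFun h i) c

lemma ex3 {r N : ℕ} (hr : 2 ≤ r) {n : Fin r → ℕ} (φ : G ≃+ (∀ i : Fin r, ZMod (n i)))
    (hN : 0 < N) (hexp : ∀ g : G, N • g = 0) {B : Type} [Fintype B] [Nonempty B]
    (z : Fin r) (c0 : ZMod (n z)) (c : ∀ i, B → ZMod (n i)) (o : B → ℕ)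
    (hc : ∀ i, i ≠ z → ∀ b, addOrderOf (c i b) = o b) (ho : ∀ b, 2 ≤ o b)
    (hdv : ∀ b, o b ∣ addOrderOf c0) (h0 : 2 ≤ addOrderOf c0)
    (hi : ∀ i, i ≠ z → ∀ y : B → ℤ, ∑ b, y b • c i b = 0 → ∀ b, y b • c i b = 0) :
    1 + ((r : ℝ) - 1) * ∑ b, (1 - 1 / (o b : ℝ)) ≤ KGd G (r - 1) := by
  have hcard : Fintype.card {i : Fin r // i ≠ z} = r - 1 := by
    simp [Fintype.card_subtype_compl]
  haveI : Nonempty {i : Fin r // i ≠ z} := by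
    rw [← Fintype.card_pos_iff, hcard]; omega
  have hord : ∀ k : {i : Fin r // i ≠ z} × B,
      addOrderOf (φ.symm (Pi.single k.1.1 (c k.1.1 k.2))) = o k.2 := fun k => by
    rw [ord_single, hc _ k.1.2]
  have := ex2_idx (d := r - 1) hN hexp (κ := {i : Fin r // i ≠ z} × B) (φ.symm (Pi.single z c0))
    (fun k => φ.symm (Pi.single k.1.1 (c k.1.1 k.2))) (by
      intro y0 y hy
      have hy' := congrArg φ hy
      simp only [map_add, map_sum, map_zsmul, AddEquiv.apply_symm_apply, map_zero] at hy'
      have key : ∀ k : {i : Fin r // i ≠ z} × B, y k • c k.1.1 k.2 = 0 := by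
        rintro ⟨i, b⟩
        refine hi i.1 i.2 (fun b => y (i, b)) ?_ b
        have h1 := congrFun hy' i.1
        simp only [Pi.add_apply, Finset.sum_apply, Pi.smul_apply, Pi.zero_apply] at h1
        rw [Pi.single_eq_of_ne i.2, smul_zero, zero_add, Fintype.sum_prod_type,
          Finset.sum_eq_single i] at h1
        · simpa using h1
        · intro j _ hj
          refine Finset.sum_eq_zero fun b _ => ?_
          rw [Pi.single_eq_of_ne (fun h => hj (Subtype.ext h.symm)), smul_zero]
        · simp
      have key2 : ∀ k : {i : Fin r // i ≠ z} × B,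
          y k • φ.symm (Pi.single k.1.1 (c k.1.1 k.2)) = 0 := by
        intro k
        rw [← map_zsmul, ← Pi.single_smul, key, Pi.single_zero, map_zero]
      refine ⟨?_, key2⟩
      rwa [Finset.sum_eq_zero (fun k _ => key2 k), add_zero] at hy) (by
      intro k
      rw [hord, ord_single]; exact hdv _) (by rw [ord_single]; exact h0) (by
      intro k; rw [hord]; exact ho _) (by
      intro f
      simp only [hord]
      rw [Fintype.sum_prod_type]
      simp only [Finset.sum_const, Finset.card_univ, hcard, nsmul_eq_mul]
      exact dvd_mul_right _ _)
  simp only [hord] at this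
  rw [Fintype.sum_prod_type] at this
  simp only [Finset.sum_const, Finset.card_univ, hcard, nsmul_eq_mul] at this
  rwa [Nat.cast_sub (by omega), Nat.cast_one] at this

lemma ex2a {r N : ℕ} (hr : 2 ≤ r) {n : Fin r → ℕ} (φ : G ≃+ (∀ i : Fin r, ZMod (n i)))
    (hN : 0 < N) (hexp : ∀ g : G, N • g = 0) (hn : ∀ i, 1 < n i)
    (z : Fin r) (hz : ∀ i, n z ∣ n i) :
    ((r : ℝ) + 1) / 2 ≤ KGd G (r - 1) := by
  have hord : ∀ i, addOrderOf ((n i / n z : ℕ) : ZMod (n i)) = n z := by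
    intro i
    have h0 : n i ≠ 0 := by have := hn i; omega
    rw [ZMod.addOrderOf_coe _ h0, Nat.gcd_eq_right (Nat.div_dvd_of_dvd (hz i)),
      Nat.div_div_self (hz i) h0]
  have := ex3 hr φ hN hexp (B := Unit) z ((n z / n z : ℕ) : ZMod (n z))
    (fun i _ => ((n i / n z : ℕ) : ZMod (n i))) (fun _ => n z) (fun i _ _ => hord i)
    (fun _ => hn z) (fun _ => by rw [hord]) (by rw [hord]; exact hn z)
    (fun i _ y hy b => by simpa using hy)
  refine le_trans ?_ this
  simp only [Finset.univ_unique, Finset.sum_const, Finset.card_singleton, one_smul]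
  have h2 : (2 : ℝ) ≤ n z := by exact_mod_cast hn z
  have h3 : 1 / (n z : ℝ) ≤ 1 / 2 := one_div_le_one_div_of_le (by norm_num) h2
  have h4 : (2 : ℝ) ≤ r := by exact_mod_cast hr
  nlinarith

lemma ex2b {r N a b : ℕ} (hr : 2 ≤ r) {n : Fin r → ℕ} (φ : G ≃+ (∀ i : Fin r, ZMod (n i)))
    (hN : 0 < N) (hexp : ∀ g : G, N • g = 0) (ha : 2 ≤ a) (hb : 2 ≤ b) (hab : Nat.Coprime a b)
    (hn : ∀ i, n i = a * b) :
    (r : ℝ) ≤ KGd G (r - 1) := by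
  have hordb : ∀ i, addOrderOf ((b : ℕ) : ZMod (n i)) = a := by
    intro i
    rw [ZMod.addOrderOf_coe _ (by rw [hn]; positivity), hn, Nat.gcd_eq_right (dvd_mul_left _ _),
      Nat.mul_div_cancel _ (by omega)]
  have horda : ∀ i, addOrderOf ((a : ℕ) : ZMod (n i)) = b := by
    intro i
    rw [ZMod.addOrderOf_coe _ (by rw [hn]; positivity), hn, Nat.gcd_eq_right (dvd_mul_right _ _),
      Nat.mul_div_cancel_left _ (by omega)]
  have hord1 : ∀ i, addOrderOf ((1 : ℕ) : ZMod (n i)) = a * b := by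
    intro i
    rw [ZMod.addOrderOf_coe _ (by rw [hn]; positivity), hn]
    simp
  have := ex3 hr φ hN hexp (B := Bool) ⟨0, by omega⟩ ((1 : ℕ) : ZMod (n _))
    (fun i t => (((if t then b else a) : ℕ) : ZMod (n i))) (fun t => if t then a else b)
    (fun i _ t => by cases t <;> simp [hordb, horda])
    (fun t => by cases t <;> simp [ha, hb]) (fun t => by rw [hord1]; cases t <;> simp)
    (by rw [hord1]; nlinarith)
    (fun i _ y hy t => by
      simp only [Fintype.sum_bool, if_true, Bool.false_eq_true, if_false] at hy
      have h1 : ((y true * b + y false * a : ℤ) : ZMod (n i)) = 0 := by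
        push_cast
        rw [← hy]
        simp [zsmul_eq_mul]
      rw [ZMod.intCast_zmod_eq_zero_iff_dvd, hn] at h1
      push_cast at h1
      have hab' : IsCoprime (a : ℤ) b := Nat.isCoprime_iff_coprime.2 hab
      have h2 : (a : ℤ) ∣ y true := by
        have : (a : ℤ) ∣ y true * b := by
          have := (dvd_mul_right (a : ℤ) b).trans h1
          exact (dvd_add_left (dvd_mul_left _ _)).1 this
        exact hab'.dvd_of_dvd_mul_right this
      have h3 : (b : ℤ) ∣ y false := by
        have : (b : ℤ) ∣ y false * a := by
          have := (dvd_mul_left (b : ℤ) a).trans h1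
          exact (dvd_add_right (dvd_mul_left _ _)).1 this
        exact hab'.symm.dvd_of_dvd_mul_right this
      cases t
      · simp only [Bool.false_eq_true, if_false]
        have : ((y false * a : ℤ) : ZMod (n i)) = 0 := by
          rw [ZMod.intCast_zmod_eq_zero_iff_dvd, hn]
          push_cast
          rw [mul_comm]
          exact mul_dvd_mul_right h3 _
        rw [zsmul_eq_mul]
        exact_mod_cast this
      · simp only [if_true]
        have : ((y true * b : ℤ) : ZMod (n i)) = 0 := by
          rw [ZMod.intCast_zmod_eq_zero_iff_dvd, hn]
          push_cast
          exact mul_dvd_mul_right h2 _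
        rw [zsmul_eq_mul]
        exact_mod_cast this)
  refine le_trans ?_ this
  simp only [Fintype.sum_bool, if_true, Bool.false_eq_true, if_false]
  have h2 : (2 : ℝ) ≤ a := by exact_mod_cast ha
  have h3 : 1 / (a : ℝ) ≤ 1 / 2 := one_div_le_one_div_of_le (by norm_num) h2
  have h2' : (2 : ℝ) ≤ b := by exact_mod_cast hb
  have h3' : 1 / (b : ℝ) ≤ 1 / 2 := one_div_le_one_div_of_le (by norm_num) h2'
  have h4 : (2 : ℝ) ≤ r := by exact_mod_cast hr
  nlinarith

lemma exists_basis {r N : ℕ} {n : Fin r → ℕ} (φ : G ≃+ (∀ i : Fin r, ZMod (n i)))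
    (hN : 2 ≤ N) (hn : ∀ i, n i = N) : ∃ e : Fin r → G, Function.Injective e ∧
      IndepN N (Finset.univ.image e) ∧ ∀ g : G, ∃ y : Fin r → ℕ, g = ∑ i, y i • e i := by
  set e : Fin r → G := fun i => φ.symm (Pi.single i 1) with he
  have hcoord : ∀ (y : Fin r → ℤ), ∀ i, φ (∑ i, y i • e i) i = (y i : ZMod (n i)) := by
    intro y i
    simp only [he, map_sum, map_zsmul, AddEquiv.apply_symm_apply, Finset.sum_apply, Pi.smul_apply]
    rw [Finset.sum_eq_single i]
    · simp [zsmul_eq_mul]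
    · intro j _ hj
      rw [Pi.single_eq_of_ne hj.symm, smul_zero]
    · simp
  have hind : ∀ y : Fin r → ℤ, ∑ i, y i • e i = 0 → ∀ i, (N : ℤ) ∣ y i := by
    intro y hy i
    have := hcoord y i
    rw [hy, map_zero, Pi.zero_apply, eq_comm, ZMod.intCast_zmod_eq_zero_iff_dvd, hn] at this
    exact this
  have hinj : Function.Injective e := by
    intro i j hij
    by_contra hne'
    have := hind (fun k => (if k = i then 1 else 0) - (if k = j then 1 else 0)) (by
      simp [sub_smul, Finset.sum_sub_distrib, hij]) i
    simp [hne'] at this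
    have := Int.le_of_dvd one_pos this
    omega
  refine ⟨e, hinj, ?_, ?_⟩
  · intro y hy g hg
    rw [Finset.sum_image (fun a _ b _ h => hinj h)] at hy
    obtain ⟨i, -, rfl⟩ := Finset.mem_image.1 hg
    exact hind _ hy i
  · intro g
    refine ⟨fun i => (φ g i).val, φ.injective (funext fun i => ?_)⟩
    have := hcoord (fun i => ((φ g i).val : ℤ)) i
    simp only [natCast_zsmul] at this
    rw [this]
    haveI : NeZero (n i) := ⟨by rw [hn]; omega⟩
    simp


end Part10

section Part11

set_option linter.unusedSectionVars false

variable {G : Type*} [AddCommGroup G] [Fintype G]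

section GroupAlg

/-- the group element `g` in the group algebra over `ZMod p` -/
noncomputable def XX (p : ℕ) (g : G) : AddMonoidAlgebra (ZMod p) G := AddMonoidAlgebra.single g 1

lemma XX_add (p : ℕ) (g h : G) : XX p (g + h) = XX p g * XX p h := by
  simp [XX, AddMonoidAlgebra.single_mul_single]

lemma XX_zero (p : ℕ) : XX p (0 : G) = 1 := rfl

lemma XX_nsmul (p m : ℕ) (g : G) : XX p (m • g) = XX p g ^ m := by
  induction m with
  | zero => simp [XX_zero]
  | succ m ih => rw [succ_nsmul, XX_add, ih, pow_succ]

lemma XX_pow {p : ℕ} (hp : p.Prime) (m : ℕ) (g : G) :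
    (XX p g - 1) ^ (p ^ m) = XX p (p ^ m • g) - 1 := by
  have : Fact p.Prime := ⟨hp⟩
  have : CharP (AddMonoidAlgebra (ZMod p) G) p := charP_of_injective_algebraMap' (ZMod p) p
  rw [sub_pow_char_pow, one_pow, XX_nsmul]

lemma XX_coeff (p : ℕ) (g x : G) (P : AddMonoidAlgebra (ZMod p) G) :
    ((XX p g - 1) * P).coeff x = P.coeff (x - g) - P.coeff x := by
  rw [sub_mul, one_mul, AddMonoidAlgebra.coeff_sub, Finsupp.sub_apply, XX,
    P.coeff_single_mul_eq_mul_coeff (x - g), one_mul]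
  intro m _
  constructor
  · rintro rfl; abel
  · rintro rfl; abel

lemma coeff_subsum (p : ℕ) (S : Multiset G) (x : G)
    (h : ((S.map fun g => XX p g - 1).prod).coeff x ≠ 0) : ∃ T ≤ S, T.sum = x := by
  induction S using Multiset.induction_on generalizing x with
  | empty =>
    refine ⟨0, le_rfl, ?_⟩
    by_contra hx
    apply h
    simp [AddMonoidAlgebra.one_def, Finsupp.single_apply]
    intro h1
    exact absurd h1 hx
  | cons g S ih =>
    rw [Multiset.map_cons, Multiset.prod_cons, XX_coeff] at h
    by_cases h1 : ((S.map fun g => XX p g - 1).prod).coeff (x - g) = 0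
    · rw [h1, zero_sub, neg_ne_zero] at h
      obtain ⟨T, hT, hs⟩ := ih x h
      exact ⟨T, hT.trans (Multiset.le_cons_self _ _), hs⟩
    · obtain ⟨T, hT, hs⟩ := ih _ h1
      refine ⟨g ::ₘ T, Multiset.cons_le_cons _ hT, ?_⟩
      rw [Multiset.sum_cons, hs]; abel

lemma coeff_zsf (p : ℕ) (S : Multiset G) (h : ∀ T ≤ S, T.sum = 0 → T = 0) :
    ((S.map fun g => XX p g - 1).prod).coeff 0 = (-1) ^ (Multiset.card S) := by
  induction S using Multiset.induction_on with
  | empty => simp [AddMonoidAlgebra.one_def]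
  | cons g S ih =>
    rw [Multiset.map_cons, Multiset.prod_cons, XX_coeff,
      ih fun T hT => h T (hT.trans (Multiset.le_cons_self _ _))]
    have h1 : ((S.map fun g => XX p g - 1).prod).coeff (0 - g) = 0 := by
      by_contra h1
      obtain ⟨T, hT, hs⟩ := coeff_subsum p S _ h1
      have := h (g ::ₘ T) (Multiset.cons_le_cons _ hT) (by rw [Multiset.sum_cons, hs]; abel)
      simp at this
    rw [h1, Multiset.card_cons, pow_succ]
    ring

lemma ideal_sup_pow {R : Type*} [CommRing R] {I J : Ideal R} {m k : ℕ} (hI : I ^ (m + 1) = ⊥)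
    (hJ : J ^ (k + 1) = ⊥) : (I ⊔ J) ^ (m + k + 1) = ⊥ := by
  have h0 : ∀ (K : Ideal R) (a b : ℕ), K ^ a = ⊥ → a ≤ b → K ^ b = ⊥ := fun K a b h hab =>
    le_bot_iff.1 (h ▸ Ideal.pow_le_pow_right hab)
  rw [← Submodule.add_eq_sup, add_pow]
  refine Finset.sum_eq_zero fun i hi => ?_
  rcases Nat.lt_or_ge m i with h | h
  · rw [h0 I _ i hI h]; simp
  · rw [h0 J _ (m + k + 1 - i) hJ (by omega)]; simp

lemma ideal_pow {R : Type*} [CommRing R] {ι : Type*} (s : Finset ι) (f : ι → R) {q : ℕ}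
    (hq : 0 < q) (h : ∀ i, f i ^ q = 0) :
    (Ideal.span (f '' s)) ^ (s.card * (q - 1) + 1) = ⊥ := by
  induction s using Finset.induction_on with
  | empty => simp
  | insert a s ha ih =>
    rw [Finset.coe_insert, Set.image_insert_eq, Ideal.span_insert, Finset.card_insert_of_notMem ha]
    have h1 : (Ideal.span {f a}) ^ (q - 1 + 1) = ⊥ := by
      rw [Nat.sub_add_cancel hq, Ideal.span_singleton_pow, h]; simp
    have := ideal_sup_pow h1 ih
    rw [show (s.card + 1) * (q - 1) + 1 = q - 1 + s.card * (q - 1) + 1 by ring]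
    exact this

/-- the key bound for zero-sum free sequences -/
lemma zsf_bound {p r j : ℕ} (hp : p.Prime) (b : Fin r → G) (hb : ∀ i, p ^ j • b i = 0)
    (S : Multiset G) (hS : ∀ T ≤ S, T.sum = 0 → T = 0) (c : G → ℕ)
    (hc : ∀ g ∈ S, ∃ m, c g = p ^ m ∧ ∃ z : Fin r → ℕ, g = p ^ m • ∑ i, z i • b i) :
    (S.map c).sum ≤ r * (p ^ j - 1) := by
  by_contra hlt
  push Not at hlt
  have : Fact p.Prime := ⟨hp⟩
  set I : Ideal (AddMonoidAlgebra (ZMod p) G) :=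
    Ideal.span ((fun i => XX p (b i) - 1) '' (Finset.univ : Finset (Fin r))) with hI
  have hI0 : I ^ (r * (p ^ j - 1) + 1) = ⊥ := by
    have := ideal_pow (Finset.univ : Finset (Fin r)) (fun i => XX p (b i) - 1) (q := p ^ j)
      (pow_pos hp.pos _) (fun i => by rw [XX_pow hp, hb, XX_zero, sub_self])
    rwa [Finset.card_univ, Fintype.card_fin] at this
  have hadd : ∀ x y : G, XX p x - 1 ∈ I → XX p y - 1 ∈ I → XX p (x + y) - 1 ∈ I := by
    intro x y hx hy
    have : XX p (x + y) - 1 = XX p x * (XX p y - 1) + (XX p x - 1) := by rw [XX_add]; ring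
    rw [this]
    exact I.add_mem (I.mul_mem_left _ hy) hx
  have hz : XX p (0 : G) - 1 ∈ I := by rw [XX_zero, sub_self]; exact I.zero_mem
  have hspan : ∀ z : Fin r → ℕ, XX p (∑ i, z i • b i) - 1 ∈ I := by
    intro z
    refine Finset.sum_induction _ (fun x => XX p x - 1 ∈ I) hadd hz fun i _ => ?_
    induction z i with
    | zero => simpa using hz
    | succ m ih =>
      rw [succ_nsmul]
      exact hadd _ _ ih (Ideal.subset_span ⟨i, by simp, rfl⟩)
  have hprod : ∀ T ≤ S, (T.map fun g => XX p g - 1).prod ∈ I ^ (T.map c).sum := by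
    intro T
    induction T using Multiset.induction_on with
    | empty => intro _; simp
    | cons g T ih =>
      intro hT
      simp only [Multiset.map_cons, Multiset.prod_cons, Multiset.sum_cons, pow_add]
      refine Ideal.mul_mem_mul ?_ (ih ((Multiset.le_cons_self _ _).trans hT))
      obtain ⟨m, hm, z, hg⟩ := hc g (Multiset.mem_of_le hT (Multiset.mem_cons_self _ _))
      rw [hm, hg, ← XX_pow hp]
      exact Ideal.pow_mem_pow (hspan z) _
  have h1 := hprod S le_rfl
  have h2 : I ^ (S.map c).sum = ⊥ := le_bot_iff.1 (hI0 ▸ Ideal.pow_le_pow_right hlt)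
  rw [h2, Ideal.mem_bot] at h1
  have h3 := coeff_zsf p S hS
  rw [h1] at h3
  have h4 : ((-1 : ZMod p)) ^ Multiset.card S ≠ 0 := pow_ne_zero _ (by simp)
  exact h4 (by rw [← h3]; simp)

end GroupAlg

lemma cross_bound {p k r : ℕ} (hp : p.Prime) (hr : 1 ≤ r) (hexp : ∀ g : G, p ^ k • g = 0)
    {e : Fin r → G} (hinj : Function.Injective e) (hi : IndepN (p ^ k) (Finset.univ.image e))
    (hgen : ∀ g : G, ∃ y : Fin r → ℕ, g = ∑ i, y i • e i)
    {G0 : Set G} {A : Multiset G} (hA : IsMinZeroSum G0 A) :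
    crossNum A ≤ r - (r - 1) / ((p ^ k : ℕ) : ℝ) := by
  have hind : ∀ y : Fin r → ℤ, ∑ i, y i • e i = 0 → ∀ i, ((p ^ k : ℕ) : ℤ) ∣ y i := by
    intro y hy i
    have := hi (fun g => if h : ∃ i, e i = g then y h.choose else 0) (by
      rw [Finset.sum_image (fun a _ b _ h => hinj h), ← hy]
      refine Finset.sum_congr rfl fun i _ => ?_
      have h : ∃ j, e j = e i := ⟨i, rfl⟩
      rw [dif_pos h, hinj h.choose_spec]) (e i) (Finset.mem_image_of_mem _ (Finset.mem_univ _))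
    have h : ∃ j, e j = e i := ⟨i, rfl⟩
    simp only [dif_pos h, hinj h.choose_spec] at this
    exact this
  have hpow : ∀ g : G, ∃ m ≤ k, addOrderOf g = p ^ m := fun g =>
    (Nat.dvd_prime_pow hp).1 (addOrderOf_dvd_of_nsmul_eq_zero (hexp g))
  obtain ⟨g0, hg0, hmax⟩ := Finset.exists_max_image A.toFinset addOrderOf
    (by obtain ⟨g, hg⟩ := Multiset.exists_mem_of_ne_zero hA.1; exact ⟨g, by simpa using hg⟩)
  rw [Multiset.mem_toFinset] at hg0
  obtain ⟨j, hjk, hj⟩ := hpow g0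
  have hmax' : ∀ g ∈ A, ∃ m ≤ j, addOrderOf g = p ^ m := by
    intro g hg
    obtain ⟨m, hm, hm'⟩ := hpow g
    refine ⟨m, ?_, hm'⟩
    have := hmax g (by simpa using hg)
    rw [hm', hj] at this
    exact (Nat.pow_le_pow_iff_right hp.one_lt).1 this
  have hAe : A = g0 ::ₘ A.erase g0 := (Multiset.cons_erase hg0).symm
  have hb := zsf_bound (r := r) (j := j) hp (fun i => p ^ (k - j) • e i) (fun i => by
      rw [smul_smul, ← pow_add, Nat.add_sub_cancel' hjk, hexp]) (A.erase g0) (by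
      intro T hT hT0
      rcases hA.2.2.2 T (hT.trans (Multiset.erase_le _ _)) hT0 with h | h
      · exact h
      · exfalso
        have h1 := Multiset.card_le_card hT
        rw [h] at h1
        have h2 := Multiset.card_erase_lt_of_mem hg0
        omega) (fun g => p ^ j / addOrderOf g) (by
      intro g hg
      obtain ⟨m, hm, hm'⟩ := hmax' g (Multiset.mem_of_mem_erase hg)
      refine ⟨j - m, by rw [hm', Nat.pow_div hm hp.pos], ?_⟩
      obtain ⟨y, hy⟩ := hgen g
      have hdv : ∀ i, p ^ (k - m) ∣ y i := by
        intro i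
        have h1 : ∑ i, ((p ^ m * y i : ℕ) : ℤ) • e i = 0 := by
          have : p ^ m • g = 0 := hm' ▸ addOrderOf_nsmul_eq_zero g
          rw [hy, Finset.smul_sum] at this
          rw [← this]
          exact Finset.sum_congr rfl fun i _ => by rw [natCast_zsmul, mul_smul]
        have h2 := Int.natCast_dvd_natCast.1 (hind _ h1 i)
        rw [show p ^ k = p ^ m * p ^ (k - m) by rw [← pow_add]; congr 1; omega] at h2
        exact Nat.dvd_of_mul_dvd_mul_left (pow_pos hp.pos _) h2
      choose z hz using hdv
      refine ⟨z, ?_⟩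
      rw [hy, Finset.smul_sum]
      refine Finset.sum_congr rfl fun i _ => ?_
      rw [smul_smul, smul_smul, hz i]
      congr 1
      rw [show k - m = (j - m) + (k - j) by omega, pow_add]
      ring)
  have hqpos : (0 : ℝ) < ((p ^ j : ℕ) : ℝ) := by exact_mod_cast pow_pos hp.pos j
  have hS : ∀ T : Multiset G, (∀ g ∈ T, g ∈ A) → ((p ^ j : ℕ) : ℝ) * crossNum T =
      (((T.map fun g => p ^ j / addOrderOf g).sum : ℕ) : ℝ) := by
    intro T
    induction T using Multiset.induction_on with
    | empty => simp [crossNum]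
    | cons g T ih =>
      intro hT
      have h1 := ih fun g hg => hT g (Multiset.mem_cons_of_mem hg)
      rw [Multiset.map_cons, Multiset.sum_cons, Nat.cast_add, ← h1]
      obtain ⟨m, hm, hm'⟩ := hmax' g (hT g (Multiset.mem_cons_self _ _))
      rw [Nat.cast_div (by rw [hm']; exact pow_dvd_pow _ hm)
        (by exact_mod_cast (addOrderOf_pos g).ne')]
      simp only [crossNum, Multiset.map_cons, Multiset.sum_cons]
      ring
  have h1 := hS A (fun g hg => hg)
  rw [hAe, Multiset.map_cons, Multiset.sum_cons, ← hAe, hj, Nat.div_self (pow_pos hp.pos _)] at h1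
  have h2 : ((p ^ j : ℕ) : ℝ) * crossNum A ≤ 1 + r * (((p ^ j : ℕ) : ℝ) - 1) := by
    rw [h1]
    have : (((p ^ j - 1 : ℕ)) : ℝ) = ((p ^ j : ℕ) : ℝ) - 1 := by
      rw [Nat.cast_sub (Nat.one_le_pow _ _ hp.pos), Nat.cast_one]
    rw [← this]
    exact_mod_cast Nat.add_le_add_left hb 1
  have h3 : crossNum A ≤ r - (r - 1) / ((p ^ j : ℕ) : ℝ) := by
    rw [← mul_le_mul_iff_right₀ hqpos]
    refine h2.trans (le_of_eq ?_)
    field_simp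
    ring
  refine h3.trans ?_
  have h4 : ((p ^ j : ℕ) : ℝ) ≤ ((p ^ k : ℕ) : ℝ) := by
    exact_mod_cast Nat.pow_le_pow_right hp.pos hjk
  have h5 : (0 : ℝ) ≤ (r : ℝ) - 1 := by
    have : (1 : ℝ) ≤ r := by exact_mod_cast hr
    linarith
  have := div_le_div_of_nonneg_left h5 hqpos h4
  linarith


end Part11

section Part12

lemma main_aux {G : Type*} [AddCommGroup G] [Fintype G]
    (r N : ℕ) (hr : 0 < r) (n : Fin r → ℕ) (hn : ∀ i, 1 < n i)
    (hz : ∀ i, n ⟨0, hr⟩ ∣ n i) (hl : ∀ i, n i ∣ N)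
    (φ : G ≃+ (∀ i : Fin r, ZMod (n i)))
    (hN : N = r + 1) (hr3 : 3 ≤ r) :
    ((∃ p k : ℕ, p.Prime ∧ 0 < k ∧ n ⟨0, hr⟩ = p ^ k ∧ N = p ^ k) →
      KGd G (r - 1) < rhoStar G (r - 1) ∧
      rhoStar G (r - 1) = 1 + ((r : ℝ) + 1) * ((r : ℝ) - 1) / ((r : ℝ) + 2) ∧
      rhoStar G (r - 1) < (r : ℝ)) ∧
    (¬(∃ p k : ℕ, p.Prime ∧ 0 < k ∧ n ⟨0, hr⟩ = p ^ k ∧ N = p ^ k) →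
      KGd G (r - 1) = rhoStar G (r - 1)) := by
  have hNpos : 0 < N := by omega
  have hexp : ∀ g : G, N • g = 0 := by
    intro g
    apply φ.injective
    rw [map_nsmul, map_zero]
    funext i
    rw [Pi.smul_apply, nsmul_eq_mul, Pi.zero_apply, (ZMod.natCast_eq_zero_iff _ _).2 (hl i),
      zero_mul]
  have hle : ∀ i, n i ≤ N := fun i => Nat.le_of_dvd hNpos (hl i)
  have hcard : Fintype.card G = ∏ i, n i := by
    have : ∀ i, NeZero (n i) := fun i => ⟨by have := hn i; omega⟩
    rw [Fintype.card_congr φ.toEquiv, Fintype.card_pi]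
    exact Finset.prod_congr rfl fun i _ => ZMod.card (n i)
  have hNr : N ^ (N - 1) = ∏ _i : Fin r, N := by
    rw [Finset.prod_const, Finset.card_univ, Fintype.card_fin]
    congr 1; omega
  have hcG : Fintype.card G ≤ N ^ (N - 1) := by
    rw [hcard, hNr]
    exact Finset.prod_le_prod' fun i _ => hle i
  have hhomo : N ^ (N - 1) ≤ Fintype.card G → ∀ i, n i = N := by
    intro h i
    by_contra hi
    have : ∏ i, n i < ∏ _i : Fin r, N := Finset.prod_lt_prod (fun i _ => by have := hn i; omega)
      (fun i _ => hle i) ⟨i, Finset.mem_univ _, lt_of_le_of_ne (hle i) hi⟩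
    rw [hcard, hNr] at h
    omega
  have hd : N - 2 = r - 1 := by omega
  have hNR : (N : ℝ) = r + 1 := by rw [hN]; push_cast; ring
  have hr3R : (3 : ℝ) ≤ r := by exact_mod_cast hr3
  have hup : ∀ {G0 : Set G}, (r - 1) ∣ sInf (deltaG0 G0) → deltaG0 G0 ≠ ∅ →
      rhoG0 G0 ≤ max (((r : ℝ) + 1) / 2) (KG0 G0) ∨ (N ^ (N - 1) ≤ Fintype.card G ∧
        rhoG0 G0 ≤ 1 + ((r : ℝ) + 1) * ((r : ℝ) - 1) / ((r : ℝ) + 2)) := by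
    intro G0 h1 h2
    have := rho_upper (n := N) (by omega) hexp hcG (G0 := G0) (by rw [hd]; exact cong_of_dvd h1) h2
    rw [hNR] at this
    rw [show (r : ℝ) + 1 - 2 = r - 1 by ring, show (r : ℝ) + 1 + 1 = r + 2 by ring] at this
    exact this
  have h2a := ex2a (by omega) φ hNpos hexp hn ⟨0, hr⟩ hz
  have hRr : 1 + ((r : ℝ) + 1) * ((r : ℝ) - 1) / ((r : ℝ) + 2) < r := by
    have : ((r : ℝ) + 1) * ((r : ℝ) - 1) / ((r : ℝ) + 2) < r - 1 := by
      rw [div_lt_iff₀ (by linarith)]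
      nlinarith
    linarith
  constructor
  · rintro ⟨p, k, hp, hk, h0, hNp⟩
    have hall : ∀ i, n i = N := fun i => by
      refine le_antisymm (hle i) ?_
      rw [hNp, ← h0]
      exact Nat.le_of_dvd (by have := hn i; omega) (hz i)
    obtain ⟨e, hinj, hi, hgen⟩ := exists_basis φ (by omega) hall
    have hlow := ex1 (n := N) (by omega) hexp hi (by
      rw [Finset.card_image_of_injective _ hinj, Finset.card_univ, Fintype.card_fin]; omega)
    rw [hd, hNR, show (r : ℝ) + 1 - 2 = r - 1 by ring,
      show (r : ℝ) + 1 + 1 = r + 2 by ring] at hlow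
    have hKc : (r : ℝ) - (r - 1) / (r + 1) <
        1 + ((r : ℝ) + 1) * ((r : ℝ) - 1) / ((r : ℝ) + 2) := by
      have h1 : (0 : ℝ) < r + 1 := by linarith
      have h2 : (0 : ℝ) < r + 2 := by linarith
      have : 1 + ((r : ℝ) + 1) * ((r : ℝ) - 1) / ((r : ℝ) + 2) - (r - (r - 1) / (r + 1)) =
          (r - 1) / ((r + 1) * (r + 2)) := by
        field_simp
        ring
      have h3 : 0 < ((r : ℝ) - 1) / ((r + 1) * (r + 2)) := div_pos (by linarith) (by positivity)
      linarith
    have hK : ∀ {G0 : Set G}, deltaG0 G0 ≠ ∅ → KG0 G0 ≤ (r : ℝ) - (r - 1) / (r + 1) := by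
      intro G0 h
      obtain ⟨A, hA⟩ := exists_atom_of_delta h
      refine csSup_le ⟨_, A, hA, rfl⟩ ?_
      rintro x ⟨B, hB, rfl⟩
      have := cross_bound (k := k) hp (by omega) (fun g => hNp ▸ hexp g) hinj (hNp ▸ hi) hgen hB
      rwa [← hNp, hNR] at this
    have hhalf : ((r : ℝ) + 1) / 2 ≤ 1 + ((r : ℝ) + 1) * ((r : ℝ) - 1) / ((r : ℝ) + 2) := by
      have h2 : (0 : ℝ) < r + 2 := by linarith
      have : ((r : ℝ) - 1) / 2 ≤ ((r : ℝ) + 1) * ((r : ℝ) - 1) / ((r : ℝ) + 2) := by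
        rw [le_div_iff₀ h2]
        nlinarith
      linarith
    have hpos : (0 : ℝ) ≤ 1 + ((r : ℝ) + 1) * ((r : ℝ) - 1) / ((r : ℝ) + 2) := by linarith
    have hupper : rhoStar G (r - 1) ≤ 1 + ((r : ℝ) + 1) * ((r : ℝ) - 1) / ((r : ℝ) + 2) := by
      refine Real.sSup_le ?_ hpos
      rintro x ⟨G0, h1, h2, rfl⟩
      rcases hup h2 h1 with h | h
      · exact h.trans (max_le hhalf ((hK h1).trans hKc.le))
      · exact h.2
    have heq := le_antisymm hupper hlow
    have hKK : KGd G (r - 1) ≤ (r : ℝ) - (r - 1) / (r + 1) := by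
      refine Real.sSup_le ?_ ?_
      · rintro x ⟨G0, h1, h2, rfl⟩
        exact hK h1
      · have : ((r : ℝ) - 1) / (r + 1) ≤ 1 := by
          rw [div_le_one (by linarith)]; linarith
        linarith
    refine ⟨?_, heq, ?_⟩
    · rw [heq]; exact hKK.trans_lt hKc
    · rw [heq]; exact hRr
  · intro hnp
    apply le_antisymm
    · refine Real.sSup_le ?_ ?_
      · rintro x ⟨G0, h1, h2, rfl⟩
        exact (KG0_le_rhoG0 hNpos hexp).trans (le_rhoStar h1 (cong_of_dvd h2))
      · refine Real.sSup_nonneg ?_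
        rintro x ⟨G0, h1, h2, rfl⟩
        exact (zero_le_one.trans (one_le_KG0 h1)).trans (KG0_le_rhoG0 hNpos hexp)
    · refine Real.sSup_le ?_ (le_trans (by positivity) h2a)
      rintro x ⟨G0, h1, h2, rfl⟩
      rcases hup h2 h1 with h | ⟨hc, h⟩
      · exact h.trans (max_le h2a (le_KGd h1 (cong_of_dvd h2)))
      · have hall := hhomo hc
        have hp := Nat.minFac_prime (show N ≠ 1 by omega)
        obtain ⟨k, b, hb, hkb⟩ := Nat.exists_eq_pow_mul_and_not_dvd hNpos.ne' N.minFac hp.ne_one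
        have hk : 0 < k := by
          rcases Nat.eq_zero_or_pos k with hk | hk
          · rw [hk, pow_zero, one_mul] at hkb
            exact absurd (hkb ▸ N.minFac_dvd) hb
          · exact hk
        have hb1 : b ≠ 1 := by
          rintro rfl
          rw [mul_one] at hkb
          exact hnp ⟨N.minFac, k, hp, hk, (hall _).trans hkb, hkb⟩
        have hb0 : b ≠ 0 := by rintro rfl; exact hb (dvd_zero _)
        have ha : 2 ≤ N.minFac ^ k := hp.two_le.trans (Nat.le_self_pow hk.ne' _)
        have hco : Nat.Coprime (N.minFac ^ k) b :=
          Nat.Coprime.pow_left _ ((Nat.Prime.coprime_iff_not_dvd hp).2 hb)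
        have := ex2b (by omega) φ hNpos hexp ha (by omega) hco (fun i => (hall i).trans hkb)
        exact (h.trans hRr.le).trans this


end Part12

/-- Suppose `G ≅ C_{n₁} ⊕ … ⊕ C_{n_r}` with `1 < n₁ ∣ … ∣ n_r`,
`D(G) ≥ 4` and `r = n_r − 1 ≥ 3`. If `n₁ = n_r = p^k` for a prime `p` and
`k ∈ ℕ`, then `K(G, r−1) < ρ*(G, r−1) = 1 + (r+1)(r−1)/(r+2) < r`; otherwise
`K(G, r−1) = ρ*(G, r−1)`. -/
theorem stmt9 {G : Type*} [AddCommGroup G] [Fintype G]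
    (r : ℕ) (hr : 0 < r) (n : Fin r → ℕ) (hn : ∀ i, 1 < n i)
    (hdvd : ∀ i j : Fin r, i ≤ j → n i ∣ n j)
    (hG : Nonempty (G ≃+ (∀ i : Fin r, ZMod (n i))))
    (hD : 4 ≤ davenport G)
    (hreq : r = n ⟨r - 1, by omega⟩ - 1) (hr3 : 3 ≤ r) :
    ((∃ p k : ℕ, p.Prime ∧ 0 < k ∧ n ⟨0, hr⟩ = p ^ k ∧ n ⟨r - 1, by omega⟩ = p ^ k) →
      KGd G (r - 1) < rhoStar G (r - 1) ∧
      rhoStar G (r - 1) = 1 + ((r : ℝ) + 1) * ((r : ℝ) - 1) / ((r : ℝ) + 2) ∧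
      rhoStar G (r - 1) < (r : ℝ)) ∧
    (¬(∃ p k : ℕ, p.Prime ∧ 0 < k ∧ n ⟨0, hr⟩ = p ^ k ∧ n ⟨r - 1, by omega⟩ = p ^ k) →
      KGd G (r - 1) = rhoStar G (r - 1)) := by
  obtain ⟨φ⟩ := hG
  have hl : 1 < n ⟨r - 1, by omega⟩ := hn _
  exact main_aux r (n ⟨r - 1, by omega⟩) hr n hn (fun i => hdvd _ _ (Fin.mk_le_mk.2 (Nat.zero_le _)))
    (fun i => hdvd _ _ (Fin.mk_le_mk.2 (by have := i.2; omega))) φ (by omega) hr3
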